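/- arXiv:2503.09818 — 8 statements merged into one kernel-verified Lean document; each statement's English description precedes it below -/
import Mathlib

section
/- There exists a constant C > 0, independent of t, such that for every t > 0 and every continuous function b : (0,1] → ℝ with sup_{0<r≤1} r^{σ+2}|b(r)| ≤ 1, there exists a C² function a_t : (0,1] → ℝ with a_t(1) = 0 solving the ODE −a_t''(r) − (N−1)a_t'(r)/r + p a_t'(r)/(βr + t r^ξ) = b(r) for 0 < r < 1, and satisfying sup_{0<r≤1} { r^σ|a_t(r)| + r^{σ+1}|a_t'(r)| } ≤ C. -/
open Real MeasureTheory Filter Set Metric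
open scoped InnerProductSpace Topology ENNReal

noncomputable section

/-- Euclidean space `ℝ^N`. -/
abbrev E (N : ℕ) := EuclideanSpace ℝ (Fin N)

/-- The Laplacian of `f : ℝ^N → ℝ`, as the sum of the pure second derivatives
in the coordinate directions. -/
def lap {N : ℕ} (f : E N → ℝ) (x : E N) : ℝ :=
  ∑ i : Fin N, iteratedFDeriv ℝ 2 f x ![EuclideanSpace.single i 1, EuclideanSpace.single i 1]

/-- `‖φ‖_X = sup_{0<|x|≤1} (|x|^σ |φ(x)| + |x|^{σ+1} |∇φ(x)|)`. -/
def normX {N : ℕ} (σ : ℝ) (φ : E N → ℝ) : ℝ :=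
  sSup ((fun x => ‖x‖ ^ σ * |φ x| + ‖x‖ ^ (σ + 1) * ‖gradient φ x‖) ''
    {x : E N | 0 < ‖x‖ ∧ ‖x‖ ≤ 1})

/-- `‖f‖_Y = sup_{0<|x|≤1} |x|^{σ+2} |f(x)|`. -/
def normY {N : ℕ} (σ : ℝ) (f : E N → ℝ) : ℝ :=
  sSup ((fun x => ‖x‖ ^ (σ + 2) * |f x|) '' {x : E N | 0 < ‖x‖ ∧ ‖x‖ ≤ 1})

/-- Membership in the space `X`: `C¹` on the punctured closed unit ball, vanishing on the
boundary, with finite `X`-norm. -/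
def MemX {N : ℕ} (σ : ℝ) (φ : E N → ℝ) : Prop :=
  ContDiffOn ℝ 1 φ {x : E N | 0 < ‖x‖ ∧ ‖x‖ ≤ 1} ∧
  (∀ x : E N, ‖x‖ = 1 → φ x = 0) ∧
  BddAbove ((fun x => ‖x‖ ^ σ * |φ x| + ‖x‖ ^ (σ + 1) * ‖gradient φ x‖) ''
    {x : E N | 0 < ‖x‖ ∧ ‖x‖ ≤ 1})

/-- Membership in the space `Y`: finite `Y`-norm. -/
def MemY {N : ℕ} (σ : ℝ) (f : E N → ℝ) : Prop :=
  BddAbove ((fun x => ‖x‖ ^ (σ + 2) * |f x|) '' {x : E N | 0 < ‖x‖ ∧ ‖x‖ ≤ 1})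

/-- The radial function `w_t(x) = ∫_{|x|}^1 (t y^ξ + β y)^{-1/(p-1)} dy`. -/
def wfun {N : ℕ} (p ξ β t : ℝ) (x : E N) : ℝ :=
  ∫ y in Set.Ioo ‖x‖ 1, (t * y ^ ξ + β * y) ^ (-(1 / (p - 1)))

/-- The explicit gradient `∇w_t(x) = -(t|x|^ξ + β|x|)^{-1/(p-1)} x/|x|`. -/
def gradw {N : ℕ} (p ξ β t : ℝ) (x : E N) : E N :=
  (-((t * ‖x‖ ^ ξ + β * ‖x‖) ^ (-(1 / (p - 1)))) / ‖x‖) • x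

/-- The linear operator `L_t^{sgn}(ζ) = -Δζ + sgn (p/(t|x|^{ξ-1}+β)) (x·∇ζ)/|x|²`,
where `sgn = 1` gives `L_t^+` and `sgn = -1` gives `L_t^-`. -/
def Lop {N : ℕ} (p ξ β t sgn : ℝ) (ζ : E N → ℝ) (x : E N) : ℝ :=
  -lap ζ x + sgn * (p / (t * ‖x‖ ^ (ξ - 1) + β)) * ⟪x, gradient ζ x⟫_ℝ / ‖x‖ ^ 2

/-- The average of `f` over the sphere `{|x| = r}` vanishes. -/
def sphAvgZero {N : ℕ} (f : E N → ℝ) (r : ℝ) : Prop :=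
  ∫ θ : Metric.sphere (0 : E N) 1, f (r • (θ : E N)) ∂((volume : Measure (E N)).toSphere) = 0

/-- The integrating factor of the first-order equation for the derivative of the solution. -/
def weight (s ξ β t r : ℝ) : ℝ := r ^ (s - ξ) * (β + t * r ^ (ξ - 1)) ^ s

lemma add_mul_rpow_pos {β t r : ℝ} (e : ℝ) (hβ : 0 < β) (ht : 0 < t) (hr : 0 < r) :
    0 < β + t * r ^ e := by
  have := rpow_pos_of_pos hr e
  positivity

lemma weight_pos {s ξ β t r : ℝ} (hβ : 0 < β) (ht : 0 < t) (hr : 0 < r) :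
    0 < weight s ξ β t r :=
  mul_pos (rpow_pos_of_pos hr _) (rpow_pos_of_pos (add_mul_rpow_pos _ hβ ht hr) _)

lemma hasDerivAt_weight {s ξ β t r : ℝ} (hβ : 0 < β) (ht : 0 < t) (hr : 0 < r) :
    HasDerivAt (weight s ξ β t)
      (weight s ξ β t r *
        ((s - ξ) / r + s * (ξ - 1) * (t * r ^ (ξ - 1)) / (r * (β + t * r ^ (ξ - 1))))) r := by
  have hD := add_mul_rpow_pos (ξ - 1) hβ ht hr
  have h1 := Real.hasDerivAt_rpow_const (x := r) (p := s - ξ) (Or.inl hr.ne')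
  have h2 := ((Real.hasDerivAt_rpow_const (x := r) (p := ξ - 1) (Or.inl hr.ne')).const_mul
    t).const_add β
  have h3 := h1.mul (h2.rpow_const (p := s) (Or.inl hD.ne'))
  refine h3.congr_deriv ?_
  rw [weight, rpow_sub_one hr.ne' (s - ξ), rpow_sub_one hr.ne' (ξ - 1), rpow_sub_one hD.ne' s]
  field_simp

lemma continuousOn_weight {s ξ β t : ℝ} (hβ : 0 < β) (ht : 0 < t) :
    ContinuousOn (weight s ξ β t) (Ioi 0) := fun _ hr =>
  (hasDerivAt_weight hβ ht hr).continuousAt.continuousWithinAt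

lemma intervalIntegrable_of_continuousOn_Ioi {f : ℝ → ℝ} (hf : ContinuousOn f (Ioi 0)) {c r : ℝ}
    (hc : 0 < c) (hr : 0 < r) : IntervalIntegrable f volume c r :=
  (hf.mono fun _ hx => lt_of_lt_of_le (lt_min hc hr) hx.1).intervalIntegrable

lemma hasDerivAt_integral_of_continuousOn_Ioi {f : ℝ → ℝ} (hf : ContinuousOn f (Ioi 0)) {c r : ℝ}
    (hc : 0 < c) (hr : 0 < r) : HasDerivAt (fun x => ∫ y in c..x, f y) (f r) r :=
  intervalIntegral.integral_hasDerivAt_right (intervalIntegrable_of_continuousOn_Ioi hf hc hr)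
    (hf.stronglyMeasurableAtFilter isOpen_Ioi r hr) (hf.continuousAt (Ioi_mem_nhds hr))

lemma abs_integral_le_of_le_rpow {f : ℝ → ℝ} {A e c d : ℝ} (hc : 0 < c) (hcd : c ≤ d)
    (he : e ≠ -1) (hf : ∀ y ∈ Icc c d, |f y| ≤ A * y ^ e) :
    |∫ y in c..d, f y| ≤ A * ((d ^ (e + 1) - c ^ (e + 1)) / (e + 1)) := by
  have h0 : (0 : ℝ) ∉ uIcc c d := fun h => by
    rw [uIcc_of_le hcd] at h
    exact absurd h.1 (not_le.2 hc)
  rw [← integral_rpow (Or.inr ⟨he, h0⟩), ← intervalIntegral.integral_const_mul, ← norm_eq_abs]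
  refine intervalIntegral.norm_integral_le_of_norm_le hcd
    (Eventually.of_forall fun y hy => hf y (Ioc_subset_Icc_self hy)) ?_
  exact (intervalIntegral.intervalIntegrable_rpow (Or.inr h0)).const_mul A

lemma abs_integral_le_of_le_rpow_of_lt {f : ℝ → ℝ} {A e c d : ℝ} (hA : 0 ≤ A) (hc : 0 < c)
    (hcd : c ≤ d) (he : e < -1) (hf : ∀ y ∈ Icc c d, |f y| ≤ A * y ^ e) :
    |∫ y in c..d, f y| ≤ A * (c ^ (e + 1) / (-(e + 1))) := by
  refine (abs_integral_le_of_le_rpow hc hcd he.ne hf).trans (mul_le_mul_of_nonneg_left ?_ hA)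
  rw [← neg_div_neg_eq]
  have := rpow_pos_of_pos (hc.trans_le hcd) (e + 1)
  exact div_le_div_of_nonneg_right (by linarith) (by linarith)

lemma abs_integral_le_of_le_rpow_of_gt {f : ℝ → ℝ} {A e c d : ℝ} (hA : 0 ≤ A) (hc : 0 < c)
    (hcd : c ≤ d) (he : -1 < e) (hf : ∀ y ∈ Icc c d, |f y| ≤ A * y ^ e) :
    |∫ y in c..d, f y| ≤ A * (d ^ (e + 1) / (e + 1)) := by
  refine (abs_integral_le_of_le_rpow hc hcd he.ne' hf).trans (mul_le_mul_of_nonneg_left ?_ hA)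
  have := rpow_pos_of_pos hc (e + 1)
  exact div_le_div_of_nonneg_right (by linarith) (by linarith)

lemma abs_weight_mul_le {s ξ β t y B : ℝ} (hβ : 0 < β) (ht : 0 < t) (hy : 0 < y)
    (hB : y ^ s * |B| ≤ 1) :
    |weight s ξ β t y * B| ≤ (β + t * y ^ (ξ - 1)) ^ s * y ^ (-ξ) := by
  rw [abs_mul, abs_of_pos (weight_pos hβ ht hy), weight, sub_eq_add_neg, rpow_add hy]
  have h1 : 0 < (β + t * y ^ (ξ - 1)) ^ s * y ^ (-ξ) :=
    mul_pos (rpow_pos_of_pos (add_mul_rpow_pos _ hβ ht hy) _) (rpow_pos_of_pos hy _)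
  calc _ = ((β + t * y ^ (ξ - 1)) ^ s * y ^ (-ξ)) * (y ^ s * |B|) := by ring
    _ ≤ _ := mul_le_of_le_one_right h1.le hB

/-- Below the transition radius the weight behaves like a decreasing power. -/
lemma abs_integral_weight_mul_le_of_le {s ξ β t r ρ : ℝ} {B : ℝ → ℝ} (hs : 0 < s) (hξ : 1 < ξ)
    (hβ : 0 < β) (ht : 0 < t) (hr : 0 < r) (hrρ : r ≤ ρ) (hρ : t * ρ ^ (ξ - 1) ≤ β)
    (hB : ∀ y ∈ Icc r ρ, y ^ s * |B y| ≤ 1) :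
    |∫ y in r..ρ, weight s ξ β t y * B y| ≤
      2 ^ s / (ξ - 1) * ((β + t * r ^ (ξ - 1)) ^ s * r ^ (1 - ξ)) := by
  have hle : ∀ y ∈ Icc r ρ, |weight s ξ β t y * B y| ≤ (2 * β) ^ s * y ^ (-ξ) := fun y hy => by
    have hy0 : 0 < y := hr.trans_le hy.1
    refine (abs_weight_mul_le hβ ht hy0 (hB y hy)).trans ?_
    have hD := add_mul_rpow_pos (ξ - 1) hβ ht hy0
    have : y ^ (ξ - 1) ≤ ρ ^ (ξ - 1) := rpow_le_rpow hy0.le hy.2 (by linarith)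
    have := mul_le_mul_of_nonneg_left this ht.le
    gcongr
    linarith
  have h := abs_integral_le_of_le_rpow_of_lt (by positivity) hr hrρ (by linarith) hle
  refine h.trans ?_
  have hT := mul_pos ht (rpow_pos_of_pos hr (ξ - 1))
  have h1 : β ^ s ≤ (β + t * r ^ (ξ - 1)) ^ s := by
    gcongr
    linarith
  rw [mul_rpow (by norm_num) hβ.le, show -ξ + 1 = 1 - ξ by ring, show -(1 - ξ) = ξ - 1 by ring]
  have h2 : 0 < ξ - 1 := by linarith
  have h3 := rpow_pos_of_pos hr (1 - ξ)
  calc _ = 2 ^ s / (ξ - 1) * (β ^ s * r ^ (1 - ξ)) := by ring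
    _ ≤ _ := by gcongr

/-- Above the transition radius the weight behaves like an increasing power. -/
lemma abs_integral_weight_mul_le_of_ge {s ξ β t r ρ : ℝ} {B : ℝ → ℝ} (hs : 1 < s) (hξ : 1 < ξ)
    (hβ : 0 < β) (ht : 0 < t) (hρ0 : 0 < ρ) (hrρ : ρ ≤ r) (hρ : β ≤ t * ρ ^ (ξ - 1))
    (hB : ∀ y ∈ Icc ρ r, y ^ s * |B y| ≤ 1) :
    |∫ y in ρ..r, weight s ξ β t y * B y| ≤
      2 ^ s / ((s - 1) * (ξ - 1)) * ((β + t * r ^ (ξ - 1)) ^ s * r ^ (1 - ξ)) := by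
  have hs0 : 0 < s - 1 := by linarith
  have hξ0 : 0 < ξ - 1 := by linarith
  have hr : 0 < r := hρ0.trans_le hrρ
  have hpow : ∀ y : ℝ, 0 < y → (t * y ^ (ξ - 1)) ^ s = t ^ s * y ^ ((ξ - 1) * s) := fun y hy => by
    rw [mul_rpow ht.le (rpow_nonneg hy.le _), rpow_mul hy.le]
  have hle : ∀ y ∈ Icc ρ r,
      |weight s ξ β t y * B y| ≤ 2 ^ s * t ^ s * y ^ ((ξ - 1) * s - ξ) := fun y hy => by
    have hy0 : 0 < y := hρ0.trans_le hy.1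
    refine (abs_weight_mul_le hβ ht hy0 (hB y hy)).trans ?_
    have hD := add_mul_rpow_pos (ξ - 1) hβ ht hy0
    have : ρ ^ (ξ - 1) ≤ y ^ (ξ - 1) := rpow_le_rpow hρ0.le hy.1 hξ0.le
    have := mul_le_mul_of_nonneg_left this ht.le
    have h1 : (β + t * y ^ (ξ - 1)) ^ s ≤ (2 * (t * y ^ (ξ - 1))) ^ s := by
      gcongr
      linarith
    rw [mul_rpow (by norm_num) (by linarith), hpow y hy0] at h1
    rw [sub_eq_add_neg ((ξ - 1) * s) ξ, rpow_add hy0]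
    have := rpow_pos_of_pos hy0 (-ξ)
    calc _ ≤ 2 ^ s * (t ^ s * y ^ ((ξ - 1) * s)) * y ^ (-ξ) := by gcongr
      _ = _ := by ring
  have he : (ξ - 1) * s - ξ + 1 = (s - 1) * (ξ - 1) := by ring
  have hpos := mul_pos hs0 hξ0
  have h := abs_integral_le_of_le_rpow_of_gt (by positivity) hρ0 hrρ (by linarith) hle
  refine h.trans ?_
  have hT := mul_pos ht (rpow_pos_of_pos hr (ξ - 1))
  have h1 : (t * r ^ (ξ - 1)) ^ s ≤ (β + t * r ^ (ξ - 1)) ^ s := by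
    gcongr
    linarith
  rw [hpow r hr] at h1
  have h3 := rpow_pos_of_pos hr (1 - ξ)
  rw [show (ξ - 1) * s - ξ + 1 = (ξ - 1) * s + (1 - ξ) by ring, rpow_add hr,
    show (ξ - 1) * s + (1 - ξ) = (s - 1) * (ξ - 1) by ring]
  calc _ = 2 ^ s / ((s - 1) * (ξ - 1)) * (t ^ s * r ^ ((ξ - 1) * s) * r ^ (1 - ξ)) := by ring
    _ ≤ _ := by gcongr

/-- The transition radius, at which the two parts of the weight balance, capped at `1`. -/
lemma exists_transition_radius {ξ β t : ℝ} (hξ : 1 < ξ) (hβ : 0 < β) (ht : 0 < t) :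
    ∃ ρ : ℝ, 0 < ρ ∧ ρ ≤ 1 ∧ t * ρ ^ (ξ - 1) ≤ β ∧ (ρ = 1 ∨ β ≤ t * ρ ^ (ξ - 1)) := by
  rcases le_total t β with h | h
  · exact ⟨1, one_pos, le_rfl, by simpa using h, Or.inl rfl⟩
  · have hξ0 : 0 < ξ - 1 := by linarith
    have hq : 0 < β / t := by positivity
    have hρ : t * ((β / t) ^ (ξ - 1)⁻¹) ^ (ξ - 1) = β := by
      rw [rpow_inv_rpow hq.le hξ0.ne']
      field_simp
    exact ⟨(β / t) ^ (ξ - 1)⁻¹, rpow_pos_of_pos hq _,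
      rpow_le_one hq.le ((div_le_one ht).2 h) (by positivity), hρ.le, Or.inr hρ.ge⟩

/-- Uniform bound for the solution `v` of the first-order equation. -/
lemma rpow_mul_abs_integral_div_weight_le {s ξ β t r ρ : ℝ} {B : ℝ → ℝ} (hs : 1 < s) (hξ : 1 < ξ)
    (hβ : 0 < β) (ht : 0 < t) (hρ0 : 0 < ρ) (hρ1 : ρ ≤ 1) (hρ : t * ρ ^ (ξ - 1) ≤ β)
    (hρ' : ρ = 1 ∨ β ≤ t * ρ ^ (ξ - 1)) (hB : ∀ y ∈ Ioc (0 : ℝ) 1, y ^ s * |B y| ≤ 1)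
    (hr : 0 < r) (hr1 : r ≤ 1) :
    |(∫ y in ρ..r, weight s ξ β t y * B y) / weight s ξ β t r| ≤
      (2 ^ s / (ξ - 1) + 2 ^ s / ((s - 1) * (ξ - 1))) * r ^ (1 - s) := by
  have hs0 : 0 < s - 1 := by linarith
  have hξ0 : 0 < ξ - 1 := by linarith
  have hD := add_mul_rpow_pos (ξ - 1) hβ ht hr
  have hG : 0 < (β + t * r ^ (ξ - 1)) ^ s * r ^ (1 - ξ) :=
    mul_pos (rpow_pos_of_pos hD _) (rpow_pos_of_pos hr _)
  have hK1 : 0 < 2 ^ s / (ξ - 1) := by positivity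
  have hK2 : 0 < 2 ^ s / ((s - 1) * (ξ - 1)) := by positivity
  rw [abs_div, abs_of_pos (weight_pos hβ ht hr), div_le_iff₀ (weight_pos hβ ht hr)]
  have hG' : r ^ (1 - s) * weight s ξ β t r = (β + t * r ^ (ξ - 1)) ^ s * r ^ (1 - ξ) := by
    rw [weight, ← mul_assoc, ← rpow_add hr, show 1 - s + (s - ξ) = 1 - ξ by ring, mul_comm]
  rw [mul_assoc, hG', add_mul]
  have hG1 := mul_pos hK1 hG
  have hG2 := mul_pos hK2 hG
  rcases le_total r ρ with h | h
  · have := abs_integral_weight_mul_le_of_le (B := B) (by linarith) hξ hβ ht hr h hρ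
      fun y hy => hB y ⟨hr.trans_le hy.1, hy.2.trans hρ1⟩
    rw [intervalIntegral.integral_symm, abs_neg]
    linarith
  · rcases hρ' with h1 | h1
    · obtain rfl : r = ρ := le_antisymm (h1 ▸ hr1) h
      rw [intervalIntegral.integral_same, abs_zero]
      linarith
    · have := abs_integral_weight_mul_le_of_ge (B := B) hs hξ hβ ht hρ0 h h1
        fun y hy => hB y ⟨hρ0.trans_le hy.1, hy.2.trans hr1⟩
      linarith

/-- solvability with uniform-in-`t` bounds of the `k = 0` mode ODE for `L_t^+`:
`-a'' - (N-1)a'/r + p a'/(βr + t r^ξ) = b` on `(0,1)` with `a(1) = 0`. -/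
theorem statement7 (N : ℕ) (hN : 3 ≤ N) (p ξ β σ : ℝ)
    (hp1 : (N : ℝ) / ((N : ℝ) - 1) < p) (hp2 : p < 2)
    (hξ : ξ = (p - 1) * ((N : ℝ) - 1)) (hβ : β = (p - 1) / (ξ - 1))
    (hσ : σ = (2 - p) / (p - 1)) :
    ∃ C : ℝ, 0 < C ∧ ∀ t : ℝ, 0 < t → ∀ b : ℝ → ℝ, ContinuousOn b (Set.Ioc 0 1) →
      (∀ r ∈ Set.Ioc (0 : ℝ) 1, r ^ (σ + 2) * |b r| ≤ 1) →
      ∃ a : ℝ → ℝ, ContDiffOn ℝ 2 a (Set.Ioc 0 1) ∧ a 1 = 0 ∧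
        (∀ r ∈ Set.Ioo (0 : ℝ) 1,
          -deriv (deriv a) r - ((N : ℝ) - 1) * deriv a r / r +
            p * deriv a r / (β * r + t * r ^ ξ) = b r) ∧
        (∀ r ∈ Set.Ioc (0 : ℝ) 1, r ^ σ * |a r| + r ^ (σ + 1) * |deriv a r| ≤ C) := by
  have hNR : (3 : ℝ) ≤ N := by exact_mod_cast hN
  have hN1 : (0 : ℝ) < (N : ℝ) - 1 := by linarith
  have hp0 : 1 < p := lt_of_le_of_lt ((one_le_div hN1).2 (by linarith)) hp1
  have hp' : 0 < p - 1 := by linarith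
  have hξ1 : 1 < ξ := by
    rw [div_lt_iff₀ hN1] at hp1
    rw [hξ]
    linarith
  have hξ0 : 0 < ξ - 1 := by linarith
  have hβ0 : 0 < β := hβ ▸ div_pos hp' hξ0
  have hσ0 : 0 < σ := hσ ▸ div_pos (by linarith) hp'
  obtain ⟨s, hs⟩ : ∃ s, s = σ + 2 := ⟨_, rfl⟩
  have hs1 : 1 < s := by linarith
  have hs0 : 0 < s - 1 := by linarith
  set K : ℝ := 2 ^ s / (ξ - 1) + 2 ^ s / ((s - 1) * (ξ - 1))
  have hK0 : 0 < K := by positivity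
  refine ⟨K / σ + K, by positivity, fun t ht b hb hbound => ?_⟩
  obtain ⟨ρ, hρ0, hρ1, hρ, hρ'⟩ := exists_transition_radius hξ1 hβ0 ht
  set B : ℝ → ℝ := fun r => b (min r 1) with hBdef
  have hBb : ∀ r ∈ Ioc (0 : ℝ) 1, B r = b r := fun r hr => by rw [hBdef]; simp [hr.2]
  have hBcont : ContinuousOn B (Ioi 0) :=
    hb.comp (by fun_prop) fun r hr => ⟨lt_min hr one_pos, min_le_right _ _⟩
  have hBle : ∀ y ∈ Ioc (0 : ℝ) 1, y ^ s * |B y| ≤ 1 := fun y hy => by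
    rw [hBb y hy, hs]
    exact hbound y hy
  have hwB : ContinuousOn (fun y => weight s ξ β t y * B y) (Ioi 0) :=
    (continuousOn_weight hβ0 ht).mul hBcont
  set v : ℝ → ℝ := fun r => -((∫ y in ρ..r, weight s ξ β t y * B y) / weight s ξ β t r) with hv
  set q : ℝ → ℝ := fun r => (s - ξ) / r +
    s * (ξ - 1) * (t * r ^ (ξ - 1)) / (r * (β + t * r ^ (ξ - 1))) with hq
  have hvderiv : ∀ r, 0 < r → HasDerivAt v (-B r - q r * v r) r := fun r hr => by
    have hw := (weight_pos (s := s) (ξ := ξ) hβ0 ht hr).ne'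
    refine ((hasDerivAt_integral_of_continuousOn_Ioi hwB hρ0 hr).div
      (hasDerivAt_weight hβ0 ht hr) hw).neg.congr_deriv ?_
    simp only [hv, hq]
    generalize (∫ y in ρ..r, weight s ξ β t y * B y) = I
    generalize (s - ξ) / r + s * (ξ - 1) * (t * r ^ (ξ - 1)) / (r * (β + t * r ^ (ξ - 1))) = Q
    field_simp
    ring
  have hvcont : ContinuousOn v (Ioi 0) := fun r hr =>
    (hvderiv r hr).continuousAt.continuousWithinAt
  have hqcont : ContinuousOn q (Ioi 0) := fun r hr => by
    have hr' : r ≠ 0 := ne_of_gt hr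
    have hD := (add_mul_rpow_pos (ξ - 1) hβ0 ht hr).ne'
    have hc : ContinuousAt (fun r : ℝ => r ^ (ξ - 1)) r := continuousAt_rpow_const _ _ (Or.inl hr')
    refine ContinuousAt.continuousWithinAt ?_
    exact (continuousAt_const.div continuousAt_id hr').add
      ((continuousAt_const.mul (continuousAt_const.mul hc)).div
        (continuousAt_id.mul (continuousAt_const.add (continuousAt_const.mul hc)))
        (mul_ne_zero hr' hD))
  have hvle : ∀ r ∈ Ioc (0 : ℝ) 1, |v r| ≤ K * r ^ (-σ - 1) := fun r hr => by
    rw [hv, abs_neg, show -σ - 1 = 1 - s by rw [hs]; ring]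
    exact rpow_mul_abs_integral_div_weight_le hs1 hξ1 hβ0 ht hρ0 hρ1 hρ hρ' hBle hr.1 hr.2
  have haderiv : ∀ r, 0 < r → HasDerivAt (fun x => ∫ y in (1 : ℝ)..x, v y) (v r) r := fun r hr =>
    hasDerivAt_integral_of_continuousOn_Ioi hvcont one_pos hr
  have hda : EqOn (deriv fun x => ∫ y in (1 : ℝ)..x, v y) v (Ioi 0) := fun r hr =>
    (haderiv r hr).deriv
  have hdv : EqOn (deriv v) (fun r => -B r - q r * v r) (Ioi 0) := fun r hr => (hvderiv r hr).deriv
  refine ⟨fun x => ∫ y in (1 : ℝ)..x, v y, ?_, intervalIntegral.integral_same, ?_, ?_⟩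
  · have hv1 : ContDiffOn ℝ 1 v (Ioi 0) := by
      rw [show (1 : WithTop ℕ∞) = 0 + 1 by norm_num, contDiffOn_succ_iff_deriv_of_isOpen isOpen_Ioi]
      refine ⟨fun r hr => (hvderiv r hr).differentiableAt.differentiableWithinAt, by simp, ?_⟩
      exact contDiffOn_zero.2 ((hBcont.neg.sub (hqcont.mul hvcont)).congr hdv)
    have : ContDiffOn ℝ 2 (fun x => ∫ y in (1 : ℝ)..x, v y) (Ioi 0) := by
      rw [show (2 : WithTop ℕ∞) = 1 + 1 by norm_num, contDiffOn_succ_iff_deriv_of_isOpen isOpen_Ioi]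
      exact ⟨fun r hr => (haderiv r hr).differentiableAt.differentiableWithinAt, by simp,
        hv1.congr hda⟩
    exact this.mono fun r hr => hr.1
  · intro r hr
    have hr0 : 0 < r := hr.1
    have hdd : deriv (deriv fun x => ∫ y in (1 : ℝ)..x, v y) r = -B r - q r * v r :=
      (hda.eventuallyEq_of_mem (Ioi_mem_nhds hr0)).deriv_eq.trans (hdv hr0)
    rw [hdd, hda hr0, hBb r ⟨hr.1, hr.2.le⟩]
    have hD := add_mul_rpow_pos (ξ - 1) hβ0 ht hr0
    have hqr : q r = ((N : ℝ) - 1) / r - p / (β * r + t * r ^ ξ) := by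
      have hrξ : r ^ ξ = r * r ^ (ξ - 1) := by
        rw [rpow_sub_one hr0.ne']
        field_simp
      have hden : β * r + t * r ^ ξ = r * (β + t * r ^ (ξ - 1)) := by
        rw [hrξ]
        ring
      have hs' : s * (p - 1) = p := by
        rw [hs, hσ]
        field_simp
        ring
      have hβ' : β * (ξ - 1) = p - 1 := by
        rw [hβ]
        field_simp
      have hsβ : s * (β * (ξ - 1)) = p := by rw [hβ', hs']
      have hN' : (N : ℝ) - 1 = ξ * (s - 1) := by
        have : (p - 1) * ((N : ℝ) - 1) = (p - 1) * (ξ * (s - 1)) := by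
          rw [← hξ]
          linear_combination (-ξ) * hs'
        exact mul_left_cancel₀ hp'.ne' this
      rw [hden, hN', hq]
      simp only
      generalize r ^ (ξ - 1) = X at hD ⊢
      field_simp
      linear_combination (-1 : ℝ) * hsβ
    rw [hqr]
    ring
  · intro r hr
    have hr0 : 0 < r := hr.1
    rw [hda hr0]
    have h1 : |∫ y in (1 : ℝ)..r, v y| ≤ K * (r ^ (-σ) / σ) := by
      rw [intervalIntegral.integral_symm, abs_neg]
      have := abs_integral_le_of_le_rpow_of_lt hK0.le hr0 hr.2 (by linarith)
        fun y hy => hvle y ⟨hr0.trans_le hy.1, hy.2⟩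
      rwa [show -σ - 1 + 1 = -σ by ring, neg_neg] at this
    have e1 : r ^ σ * r ^ (-σ) = 1 := by rw [← rpow_add hr0]; simp
    have e2 : r ^ (σ + 1) * r ^ (-σ - 1) = 1 := by rw [← rpow_add hr0]; simp
    have p1 := rpow_pos_of_pos hr0 σ
    have p2 := rpow_pos_of_pos hr0 (σ + 1)
    calc _ ≤ r ^ σ * (K * (r ^ (-σ) / σ)) + r ^ (σ + 1) * (K * r ^ (-σ - 1)) := by
          gcongr
          exact hvle r hr
      _ = K / σ * (r ^ σ * r ^ (-σ)) + K * (r ^ (σ + 1) * r ^ (-σ - 1)) := by ring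
      _ = K / σ + K := by rw [e1, e2]; ring
end
end

section
/- Let λ ≥ N − 1 be an eigenvalue λ_k (k ≥ 1) of the Laplace–Beltrami operator −Δ_{S^{N−1}} on the unit sphere S^{N−1}. Then there exists a constant C = C(λ) > 0 such that for every continuous function b : (0,1] → ℝ with sup_{0<r<1} r^{σ+2}|b(r)| ≤ 1, there exists a C² function a : (0,1] → ℝ with a(1) = 0 satisfying −a''(r) − (N−1)a'(r)/r + λ a(r)/r² − p a'(r)/(βr) = b(r) for 0 < r < 1, and sup_{0<r<1} r^σ|a(r)| ≤ C. -/
open Real MeasureTheory Filter Set Metric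
open scoped InnerProductSpace Topology ENNReal

noncomputable section

/-- If `|f s| ≤ s ^ (c - 1)` near `0` and `c > 0`, then `f` is integrable up to `0`, and its
primitive is controlled by `r ^ c / c`. -/
lemma intervalIntegrable_and_abs_integral_le_of_abs_le_rpow {f : ℝ → ℝ} {c : ℝ} (hc : 0 < c)
    (hf : ContinuousOn f (Ioi 0)) (hb : ∀ s ∈ Ioc (0 : ℝ) 1, |f s| ≤ s ^ (c - 1)) {r : ℝ}
    (hr0 : 0 ≤ r) (hr1 : r ≤ 1) :
    IntervalIntegrable f volume 0 r ∧ |∫ s in (0 : ℝ)..r, f s| ≤ r ^ c / c := by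
  have hint : IntervalIntegrable (fun s : ℝ => s ^ (c - 1)) volume 0 r :=
    intervalIntegral.intervalIntegrable_rpow' (by linarith)
  have hle : ∀ s ∈ Ioc 0 r, ‖f s‖ ≤ s ^ (c - 1) := fun s hs => hb s ⟨hs.1, hs.2.trans hr1⟩
  constructor
  · refine hint.mono_fun ?_ ?_
    · rw [uIoc_of_le hr0]
      exact (hf.mono fun s hs => hs.1).aestronglyMeasurable measurableSet_Ioc
    · rw [uIoc_of_le hr0]
      exact (ae_restrict_iff' measurableSet_Ioc).2
        (Eventually.of_forall fun s hs => (hle s hs).trans (le_abs_self _))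
  · have h := intervalIntegral.norm_integral_le_of_norm_le hr0
      (Eventually.of_forall hle) hint
    rw [integral_rpow (Or.inl (by linarith))] at h
    simpa [Real.zero_rpow hc.ne'] using h

/-- The primitive from `1` of a function with `|f s| ≤ s ^ (-c - 1)`, `c > 0`, is controlled by
`r ^ (-c) / c`. -/
lemma abs_integral_one_le_of_abs_le_rpow {f : ℝ → ℝ} {c : ℝ} (hc : 0 < c)
    (hb : ∀ s ∈ Ioc (0 : ℝ) 1, |f s| ≤ s ^ (-c - 1)) {r : ℝ} (hr0 : 0 < r) (hr1 : r ≤ 1) :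
    |∫ s in (1 : ℝ)..r, f s| ≤ r ^ (-c) / c := by
  have h0 : (0 : ℝ) ∉ uIcc r 1 := by
    rw [uIcc_of_le hr1]
    exact fun h => hr0.not_ge h.1
  have hle : ∀ s ∈ Ioc r 1, ‖f s‖ ≤ s ^ (-c - 1) := fun s hs => hb s ⟨hr0.trans hs.1, hs.2⟩
  have h := intervalIntegral.norm_integral_le_of_norm_le (μ := volume) hr1 (Eventually.of_forall hle)
    (intervalIntegral.intervalIntegrable_rpow (Or.inr h0))
  rw [integral_rpow (Or.inr ⟨by linarith, h0⟩)] at h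
  rw [intervalIntegral.integral_symm, abs_neg]
  refine h.trans ?_
  have e : -c - 1 + 1 = -c := by ring
  rw [e, Real.one_rpow, div_neg, ← neg_div]
  gcongr
  linarith

/-- A solution of the Euler equation `r² a'' + (m - n + 1) r a' - m n a = -g` with `a 1 = 0`,
whose growth at `0` is that of the right-hand side. -/
lemma exists_euler_solution {m n σ : ℝ} (hσ : 0 ≤ σ) (hm : σ < m) (hn : 0 < n) {g : ℝ → ℝ}
    (hg : ContinuousOn g (Ioi 0)) (hgb : ∀ s ∈ Ioc (0 : ℝ) 1, |g s| ≤ s ^ (-σ)) :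
    ∃ a a₁ a₂ : ℝ → ℝ, (∀ r, 0 < r → HasDerivAt a (a₁ r) r) ∧
      (∀ r, 0 < r → HasDerivAt a₁ (a₂ r) r) ∧ ContinuousOn a₂ (Ioi 0) ∧ a 1 = 0 ∧
      (∀ r, 0 < r → r ^ 2 * a₂ r + (m - n + 1) * r * a₁ r - m * n * a r = -g r) ∧
      ∀ r ∈ Ioc (0 : ℝ) 1, r ^ σ * |a r| ≤ (2 / (m - σ) + 1 / (n + σ)) / (m + n) := by
  have hmn : 0 < m + n := by linarith
  have hms : 0 < m - σ := by linarith
  have hns : 0 < n + σ := by linarith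
  have hpow : ∀ c : ℝ, ContinuousOn (fun s : ℝ => s ^ c) (Ioi 0) := fun c =>
    continuousOn_id.rpow_const fun s hs => Or.inl (ne_of_gt hs)
  have hprod : ∀ c : ℝ, ∀ s ∈ Ioc (0 : ℝ) 1, |s ^ c * g s| ≤ s ^ (c - σ) := by
    intro c s hs
    rw [abs_mul, abs_of_pos (Real.rpow_pos_of_pos hs.1 c), sub_eq_add_neg, Real.rpow_add hs.1]
    exact mul_le_mul_of_nonneg_left (hgb s hs) (Real.rpow_pos_of_pos hs.1 c).le
  set f₁ : ℝ → ℝ := fun s => s ^ (m - 1) * g s with hf₁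
  set f₂ : ℝ → ℝ := fun s => s ^ (-n - 1) * g s with hf₂
  have hf₁c : ContinuousOn f₁ (Ioi 0) := (hpow _).mul hg
  have hf₂c : ContinuousOn f₂ (Ioi 0) := (hpow _).mul hg
  have hf₁b : ∀ s ∈ Ioc (0 : ℝ) 1, |f₁ s| ≤ s ^ ((m - σ) - 1) := fun s hs => by
    have := hprod (m - 1) s hs
    rwa [show m - 1 - σ = m - σ - 1 by ring] at this
  have hf₂b : ∀ s ∈ Ioc (0 : ℝ) 1, |f₂ s| ≤ s ^ (-(n + σ) - 1) := fun s hs => by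
    have := hprod (-n - 1) s hs
    rwa [show -n - 1 - σ = -(n + σ) - 1 by ring] at this
  have hii : ∀ f : ℝ → ℝ, ContinuousOn f (Ioi 0) → ∀ r, 0 < r →
      IntervalIntegrable f volume 1 r := fun f hf r hr =>
    (hf.mono fun s hs => (lt_min one_pos hr).trans_le hs.1).intervalIntegrable
  have hmeas : ∀ f : ℝ → ℝ, ContinuousOn f (Ioi 0) → ∀ r, 0 < r →
      StronglyMeasurableAtFilter f (𝓝 r) := fun f hf r hr =>
    hf.stronglyMeasurableAtFilter isOpen_Ioi r hr
  have hcont : ∀ f : ℝ → ℝ, ContinuousOn f (Ioi 0) → ∀ r, 0 < r → ContinuousAt f r :=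
    fun f hf r hr => hf.continuousAt (Ioi_mem_nhds hr)
  set F : ℝ → ℝ := fun r => ∫ s in (0 : ℝ)..r, f₁ s with hF
  set G : ℝ → ℝ := fun r => ∫ s in (1 : ℝ)..r, f₂ s with hG
  have hF' : ∀ r, 0 < r → HasDerivAt F (f₁ r) r := fun r hr =>
    intervalIntegral.integral_hasDerivAt_right
      ((intervalIntegrable_and_abs_integral_le_of_abs_le_rpow hms hf₁c hf₁b zero_le_one
        le_rfl).1.trans (hii f₁ hf₁c r hr)) (hmeas f₁ hf₁c r hr) (hcont f₁ hf₁c r hr)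
  have hG' : ∀ r, 0 < r → HasDerivAt G (f₂ r) r := fun r hr =>
    intervalIntegral.integral_hasDerivAt_right (hii f₂ hf₂c r hr) (hmeas f₂ hf₂c r hr)
      (hcont f₂ hf₂c r hr)
  have hFb : ∀ r, 0 < r → r ≤ 1 → |F r| ≤ r ^ (m - σ) / (m - σ) := fun r hr hr1 =>
    (intervalIntegrable_and_abs_integral_le_of_abs_le_rpow hms hf₁c hf₁b hr.le hr1).2
  have hGb : ∀ r, 0 < r → r ≤ 1 → |G r| ≤ r ^ (-(n + σ)) / (n + σ) := fun r hr hr1 =>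
    abs_integral_one_le_of_abs_le_rpow hns hf₂b hr hr1
  have hrp : ∀ c r : ℝ, 0 < r → HasDerivAt (fun s : ℝ => s ^ c) (c * r ^ (c - 1)) r :=
    fun c r hr => Real.hasDerivAt_rpow_const (Or.inl hr.ne')
  have hFc : ContinuousOn F (Ioi 0) := fun r hr => (hF' r hr).continuousAt.continuousWithinAt
  have hGc : ContinuousOn G (Ioi 0) := fun r hr => (hG' r hr).continuousAt.continuousWithinAt
  have e₁ : ∀ r : ℝ, 0 < r → r ^ (-m - 1) = (r ^ m)⁻¹ / r := fun r hr => by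
    rw [Real.rpow_sub_one hr.ne', Real.rpow_neg hr.le]
  have e₂ : ∀ r : ℝ, 0 < r → r ^ (-m - 1 - 1) = (r ^ m)⁻¹ / r / r := fun r hr => by
    rw [Real.rpow_sub_one hr.ne', e₁ r hr]
  have e₃ : ∀ r : ℝ, 0 < r → r ^ (n - 1) = r ^ n / r := fun r hr => Real.rpow_sub_one hr.ne' _
  have e₄ : ∀ r : ℝ, 0 < r → r ^ (n - 1 - 1) = r ^ n / r / r := fun r hr => by
    rw [Real.rpow_sub_one hr.ne', e₃ r hr]
  have e₅ : ∀ r : ℝ, 0 < r → f₁ r = r ^ m / r * g r := fun r hr => by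
    simp only [hf₁, Real.rpow_sub_one hr.ne']
  have e₆ : ∀ r : ℝ, 0 < r → f₂ r = (r ^ n)⁻¹ / r * g r := fun r hr => by
    simp only [hf₂, Real.rpow_sub_one hr.ne', Real.rpow_neg hr.le]
  refine ⟨fun r => (r ^ (-m) * F r - r ^ n * (G r + F 1)) / (m + n),
    fun r => (-m * (r ^ (-m - 1) * F r) - n * (r ^ (n - 1) * (G r + F 1))) / (m + n),
    fun r => (m * (m + 1) * (r ^ (-m - 1 - 1) * F r)
      - n * (n - 1) * (r ^ (n - 1 - 1) * (G r + F 1))) / (m + n) - g r / r ^ 2,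
    ?_, ?_, ?_, ?_, ?_, ?_⟩
  · intro r hr
    refine ((((hrp (-m) r hr).mul (hF' r hr)).sub
      ((hrp n r hr).mul ((hG' r hr).add_const (F 1)))).div_const (m + n)).congr_deriv ?_
    have hP := (Real.rpow_pos_of_pos hr m).ne'
    have hQ := (Real.rpow_pos_of_pos hr n).ne'
    beta_reduce
    rw [e₁ r hr, e₃ r hr, e₅ r hr, e₆ r hr, Real.rpow_neg hr.le]
    field_simp
    ring
  · intro r hr
    refine (((((hrp (-m - 1) r hr).mul (hF' r hr)).const_mul (-m)).sub
      (((hrp (n - 1) r hr).mul ((hG' r hr).add_const (F 1))).const_mul n)).div_const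
        (m + n)).congr_deriv ?_
    have hP := (Real.rpow_pos_of_pos hr m).ne'
    have hQ := (Real.rpow_pos_of_pos hr n).ne'
    beta_reduce
    rw [e₂ r hr, e₄ r hr, e₁ r hr, e₃ r hr, e₅ r hr, e₆ r hr]
    field_simp
    ring
  · refine ((((continuousOn_const.mul ((hpow _).mul hFc)).sub
      (continuousOn_const.mul ((hpow _).mul (hGc.add continuousOn_const)))).div_const _).sub
        (hg.div (continuousOn_id.pow 2) fun r hr => pow_ne_zero 2 (ne_of_gt hr)))
  · simp [hG]
  · intro r hr
    have hP := (Real.rpow_pos_of_pos hr m).ne'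
    simp only [e₂ r hr, e₄ r hr, e₁ r hr, e₃ r hr, Real.rpow_neg hr.le]
    field_simp
    ring
  · rintro r ⟨hr, hr1⟩
    have hσ0 := Real.rpow_pos_of_pos hr σ
    have hA : r ^ σ * |r ^ (-m) * F r| ≤ 1 / (m - σ) := by
      rw [abs_mul, abs_of_pos (Real.rpow_pos_of_pos hr _)]
      calc r ^ σ * (r ^ (-m) * |F r|)
          ≤ r ^ σ * (r ^ (-m) * (r ^ (m - σ) / (m - σ))) := by
            gcongr
            exact hFb r hr hr1
        _ = r ^ (σ + (-m) + (m - σ)) / (m - σ) := by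
            rw [Real.rpow_add hr, Real.rpow_add hr]
            ring
        _ = 1 / (m - σ) := by
            rw [show σ + (-m) + (m - σ) = 0 by ring, Real.rpow_zero]
    have hB : r ^ σ * |r ^ n * G r| ≤ 1 / (n + σ) := by
      rw [abs_mul, abs_of_pos (Real.rpow_pos_of_pos hr _)]
      calc r ^ σ * (r ^ n * |G r|)
          ≤ r ^ σ * (r ^ n * (r ^ (-(n + σ)) / (n + σ))) := by
            gcongr
            exact hGb r hr hr1
        _ = r ^ (σ + n + (-(n + σ))) / (n + σ) := by
            rw [Real.rpow_add hr, Real.rpow_add hr]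
            ring
        _ = 1 / (n + σ) := by
            rw [show σ + n + (-(n + σ)) = 0 by ring, Real.rpow_zero]
    have hD : r ^ σ * |r ^ n * F 1| ≤ 1 / (m - σ) := by
      have h1 := hFb 1 one_pos le_rfl
      rw [Real.one_rpow] at h1
      rw [abs_mul, abs_of_pos (Real.rpow_pos_of_pos hr _), ← mul_assoc, ← Real.rpow_add hr]
      calc r ^ (σ + n) * |F 1| ≤ 1 * (1 / (m - σ)) := by
            gcongr
            exact Real.rpow_le_one hr.le hr1 (by linarith)
        _ = 1 / (m - σ) := one_mul _
    rw [abs_div, abs_of_pos hmn, ← mul_div_assoc]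
    gcongr
    calc r ^ σ * |r ^ (-m) * F r - r ^ n * (G r + F 1)|
        ≤ r ^ σ * (|r ^ (-m) * F r| + (|r ^ n * G r| + |r ^ n * F 1|)) := by
          gcongr
          rw [mul_add]
          exact (abs_sub _ _).trans (add_le_add_right (abs_add_le _ _) _)
      _ ≤ 2 / (m - σ) + 1 / (n + σ) := by
          rw [mul_add, mul_add, show 2 / (m - σ) = 1 / (m - σ) + 1 / (m - σ) by ring]
          linarith

/-- solvability of the `k`-th mode (`k ≥ 1`) ODE for `L_0^-`:
`-a'' - (N-1)a'/r + λ a/r² - p a'/(βr) = b` on `(0,1)` with `a(1) = 0` and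
`sup_{0<r<1} r^σ |a(r)| ≤ C(λ)`, where `λ = λ_k = k(k+N-2) ≥ N-1` is an eigenvalue of
`-Δ_{S^{N-1}}`. -/
theorem statement8 (N : ℕ) (hN : 3 ≤ N) (p ξ β σ : ℝ)
    (hp1 : (N : ℝ) / ((N : ℝ) - 1) < p) (hp2 : p < 2)
    (hξ : ξ = (p - 1) * ((N : ℝ) - 1)) (hβ : β = (p - 1) / (ξ - 1))
    (hσ : σ = (2 - p) / (p - 1))
    (lam : ℝ) (hlam1 : (N : ℝ) - 1 ≤ lam)
    (hlam : ∃ k : ℕ, 1 ≤ k ∧ lam = (k : ℝ) * ((k : ℝ) + (N : ℝ) - 2)) :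
    ∃ C : ℝ, 0 < C ∧ ∀ b : ℝ → ℝ, ContinuousOn b (Set.Ioc 0 1) →
      (∀ r ∈ Set.Ioo (0 : ℝ) 1, r ^ (σ + 2) * |b r| ≤ 1) →
      ∃ a : ℝ → ℝ, ContDiffOn ℝ 2 a (Set.Ioc 0 1) ∧ a 1 = 0 ∧
        (∀ r ∈ Set.Ioo (0 : ℝ) 1,
          -deriv (deriv a) r - ((N : ℝ) - 1) * deriv a r / r + lam * a r / r ^ 2 -
            p * deriv a r / (β * r) = b r) ∧
        (∀ r ∈ Set.Ioo (0 : ℝ) 1, r ^ σ * |a r| ≤ C) := by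
  have hN' : (3 : ℝ) ≤ N := by exact_mod_cast hN
  have hq : 0 < p - 1 := by
    have : 1 < (N : ℝ) / ((N : ℝ) - 1) := by
      rw [lt_div_iff₀ (by linarith)]
      linarith
    linarith
  have hξ1 : 0 < ξ - 1 := by
    rw [div_lt_iff₀ (by linarith)] at hp1
    rw [hξ]
    linarith
  have hβ0 : 0 < β := hβ ▸ div_pos hq hξ1
  have hσ0 : 0 < σ := hσ ▸ div_pos (by linarith) hq
  have hσN : σ < N - 2 := by
    rw [hσ, div_lt_iff₀ hq]
    linarith
  set K : ℝ := N - 2 + p / β with hK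
  have hKσ : σ < K := by
    have : 0 < p / β := div_pos (by linarith) hβ0
    linarith
  have hl : 0 < lam := by linarith
  set D : ℝ := √(K ^ 2 + 4 * lam) with hD
  have hDsq : D ^ 2 = K ^ 2 + 4 * lam := Real.sq_sqrt (by positivity)
  have hKD : K < D := Real.lt_sqrt_of_sq_lt (by linarith)
  obtain ⟨m, hm⟩ : ∃ m, m = (D + K) / 2 := ⟨_, rfl⟩
  obtain ⟨n, hn⟩ : ∃ n, n = (D - K) / 2 := ⟨_, rfl⟩
  have hmσ : σ < m := by linarith
  have hn0 : 0 < n := by linarith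
  have hmn : m * n = lam := by
    rw [hm, hn]
    linear_combination hDsq / 4
  have hmnK : m - n + 1 = N - 1 + p / β := by
    rw [hm, hn, hK]
    ring
  refine ⟨(2 / (m - σ) + 1 / (n + σ)) / (m + n), ?_, fun b hb hbb => ?_⟩
  · have h1 : 0 < m - σ := by linarith
    have h2 : 0 < n + σ := by linarith
    have h3 : 0 < m + n := by linarith
    positivity
  have hg : ContinuousOn (fun s : ℝ => s ^ 2 * b (min s 1)) (Ioi 0) :=
    (continuousOn_id.pow 2).mul (hb.comp (continuous_id.min continuous_const).continuousOn
      fun s hs => ⟨lt_min hs one_pos, min_le_right _ _⟩)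
  have hbc : ∀ s ∈ Ioc (0 : ℝ) 1, s ^ (σ + 2) * |b s| ≤ 1 := by
    have hcl : ∀ s ∈ Ioc (0 : ℝ) 1, s ∈ closure (Ioo (0 : ℝ) 1) := fun s hs => by
      rw [closure_Ioo zero_ne_one]
      exact ⟨hs.1.le, hs.2⟩
    intro s hs
    refine ContinuousWithinAt.closure_le (hcl s hs) ?_ continuousWithinAt_const hbb
    exact ((Real.continuousAt_rpow_const _ _ (Or.inl hs.1.ne')).continuousWithinAt).mul
      ((hb s hs).mono Ioo_subset_Ioc_self).abs
  have hgb : ∀ s ∈ Ioc (0 : ℝ) 1, |s ^ 2 * b (min s 1)| ≤ s ^ (-σ) := by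
    intro s hs
    have h := hbc s hs
    rw [min_eq_left hs.2, abs_mul, abs_of_pos (pow_pos hs.1 2), Real.rpow_neg hs.1.le,
      ← one_div, le_div_iff₀ (Real.rpow_pos_of_pos hs.1 σ)]
    rw [Real.rpow_add hs.1, Real.rpow_two] at h
    linarith
  obtain ⟨a, a₁, a₂, ha, ha₁, ha₂, ha1, hode, hbd⟩ :=
    exists_euler_solution hσ0.le hmσ hn0 hg hgb
  have hd : ∀ r, 0 < r → deriv a r = a₁ r := fun r hr => (ha r hr).deriv
  have hdd : ∀ r, 0 < r → deriv (deriv a) r = a₂ r := fun r hr => by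
    have : deriv a =ᶠ[𝓝 r] a₁ := by
      filter_upwards [Ioi_mem_nhds hr] with s hs using hd s hs
    rw [this.deriv_eq, (ha₁ r hr).deriv]
  refine ⟨a, ?_, ha1, fun r hr => ?_, fun r hr => hbd r ⟨hr.1, hr.2.le⟩⟩
  · have h1 : ContDiffOn ℝ 1 (deriv a) (Ioi 0) := by
      rw [show (1 : WithTop ℕ∞) = 0 + 1 by norm_num, contDiffOn_succ_iff_deriv_of_isOpen isOpen_Ioi]
      refine ⟨fun r hr => ?_, by simp, ?_⟩
      · exact (((ha₁ r hr).congr_of_eventuallyEq (by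
          filter_upwards [Ioi_mem_nhds hr] with s hs using hd s hs)).differentiableAt
            ).differentiableWithinAt
      · exact contDiffOn_zero.2 (ha₂.congr fun r hr => hdd r hr)
    have h2 : ContDiffOn ℝ 2 a (Ioi 0) := by
      rw [show (2 : WithTop ℕ∞) = 1 + 1 by norm_num, contDiffOn_succ_iff_deriv_of_isOpen isOpen_Ioi]
      exact ⟨fun r hr => (ha r hr).differentiableAt.differentiableWithinAt, by simp, h1⟩
    exact h2.mono Ioc_subset_Ioi_self
  · have h := hode r hr.1
    have hr0 := hr.1.ne'
    rw [hmn, hmnK, min_eq_left hr.2.le] at h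
    rw [hdd r hr.1, hd r hr.1]
    have hb' : b r = -(r ^ 2 * a₂ r + (N - 1 + p / β) * r * a₁ r - lam * a r) / r ^ 2 := by
      rw [h]
      field_simp
    rw [hb']
    field_simp
    ring
end
end

section
/- There exists a constant C > 0, independent of t, such that for every t > 0 and every continuous function b : (0,1] → ℝ with sup_{0<r<1} r^{σ+2}|b(r)| < ∞, there exists a C² function a_t : (0,1] → ℝ with a_t(1) = 0 solving −a_t''(r) − (N−1)a_t'(r)/r − p a_t'(r)/(βr + t r^ξ) = b(r) for 0 < r ≤ 1, and satisfying sup_{0<r<1} r^{σ+1}|a_t'(r)| ≤ C · sup_{0<r<1} r^{σ+2}|b(r)|. -/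
open Real MeasureTheory Filter Set Metric
open scoped InnerProductSpace Topology ENNReal

noncomputable section

/-- A function with a continuous second derivative on an open set is `C²` there. -/
theorem contDiffOn_two_of_hasDerivAt {f u v : ℝ → ℝ} {s : Set ℝ} (hs : IsOpen s)
    (hf : ∀ r ∈ s, HasDerivAt f (u r) r) (hu : ∀ r ∈ s, HasDerivAt u (v r) r)
    (hv : ContinuousOn v s) : ContDiffOn ℝ 2 f s := by
  have hu1 : ContDiffOn ℝ 1 u s := by
    rw [show (1 : WithTop ℕ∞) = 0 + 1 by norm_num, contDiffOn_succ_iff_deriv_of_isOpen hs]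
    refine ⟨fun r hr => (hu r hr).differentiableAt.differentiableWithinAt, by simp, ?_⟩
    rw [contDiffOn_zero]
    exact hv.congr fun r hr => (hu r hr).deriv
  rw [show (2 : WithTop ℕ∞) = 1 + 1 by norm_num, contDiffOn_succ_iff_deriv_of_isOpen hs]
  exact ⟨fun r hr => (hf r hr).differentiableAt.differentiableWithinAt, by simp,
    hu1.congr fun r hr => (hf r hr).deriv⟩

/-- Solvability of `-a'' - κ a' / r - k a' = b` with a weighted gradient bound, where the
coefficient `k` is the logarithmic derivative of a positive monotone function `ν`. The solution
is `a' = -(r ^ κ ν)⁻¹ ∫₀ʳ s ^ κ ν b`. -/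
theorem exists_solution_of_monotone_factor {κ σ M : ℝ} (hκ : σ + 1 < κ) {ν k b : ℝ → ℝ}
    (hν : ∀ r ∈ Ioi (0 : ℝ), 0 < ν r) (hmono : MonotoneOn ν (Ioi 0))
    (hder : ∀ r ∈ Ioi (0 : ℝ), HasDerivAt ν (ν r * k r) r) (hk : ContinuousOn k (Ioi 0))
    (hb : ContinuousOn b (Ioi 0))
    (hM : ∀ r ∈ Ioo (0 : ℝ) 1, r ^ (σ + 2) * |b r| ≤ M) :
    ∃ a : ℝ → ℝ, ContDiffOn ℝ 2 a (Ioi 0) ∧ a 1 = 0 ∧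
      (∀ r ∈ Ioi (0 : ℝ), -deriv (deriv a) r - κ * deriv a r / r - k r * deriv a r = b r) ∧
      (∀ r ∈ Ioo (0 : ℝ) 1, r ^ (σ + 1) * |deriv a r| ≤ (κ - σ - 1)⁻¹ * M) := by
  set g : ℝ → ℝ := fun s => s ^ κ * ν s * b s with hg
  have hνc : ContinuousOn ν (Ioi 0) := fun r hr => (hder r hr).continuousAt.continuousWithinAt
  have hpow : ContinuousOn (fun s : ℝ => s ^ κ) (Ioi 0) := fun s hs =>
    (continuousAt_rpow_const s κ (Or.inl (ne_of_gt hs))).continuousWithinAt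
  have hgc : ContinuousOn g (Ioi 0) := (hpow.mul hνc).mul hb
  have hbound : ∀ r ∈ Ioo (0 : ℝ) 1, ∀ s ∈ Ioc 0 r, ‖g s‖ ≤ ν r * M * s ^ (κ - σ - 2) := by
    intro r hr s hs
    have hs0 : 0 < s := hs.1
    have h1 := hM s ⟨hs.1, hs.2.trans_lt hr.2⟩
    have h2 : ν s ≤ ν r := hmono hs.1 hr.1 hs.2
    have h3 := hν s hs.1
    have hM0 : 0 ≤ M := le_trans (by positivity) h1
    have h4 : s ^ κ = s ^ (κ - σ - 2) * s ^ (σ + 2) := by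
      rw [← rpow_add hs0]; congr 1; ring
    calc ‖g s‖ = s ^ κ * ν s * |b s| := by
          rw [hg, norm_eq_abs, abs_mul, abs_of_pos (by positivity)]
      _ = ν s * (s ^ (σ + 2) * |b s|) * s ^ (κ - σ - 2) := by rw [h4]; ring
      _ ≤ ν r * M * s ^ (κ - σ - 2) := by gcongr; exact h3.le.trans h2
  have hexp : -1 < κ - σ - 2 := by linarith
  have hgint : ∀ r ∈ Ioi (0 : ℝ), IntervalIntegrable g volume 0 r := by
    have hhalf : IntervalIntegrable g volume 0 (1 / 2) := by
      refine ((intervalIntegral.intervalIntegrable_rpow' (a := 0) (b := 1 / 2) hexp).const_mul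
        (ν (1 / 2) * M)).mono_fun' ?_ ?_
      · refine (hgc.mono ?_).aestronglyMeasurable measurableSet_uIoc
        rw [uIoc_of_le (by norm_num)]
        exact fun s hs => hs.1
      · refine (ae_restrict_iff' measurableSet_uIoc).2 (Eventually.of_forall fun s hs => ?_)
        rw [uIoc_of_le (by norm_num)] at hs
        exact hbound (1 / 2) (by norm_num) s hs
    intro r hr
    refine hhalf.trans (hgc.mono fun s hs => ?_).intervalIntegrable
    exact lt_of_lt_of_le (lt_min (by norm_num) hr) hs.1
  set G : ℝ → ℝ := fun r => ∫ s in (0 : ℝ)..r, g s with hG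
  have hGd : ∀ r ∈ Ioi (0 : ℝ), HasDerivAt G (g r) r := fun r hr =>
    intervalIntegral.integral_hasDerivAt_right (hgint r hr)
      (hgc.stronglyMeasurableAtFilter isOpen_Ioi r hr) (hgc.continuousAt (Ioi_mem_nhds hr))
  set u : ℝ → ℝ := fun r => -(G r / (r ^ κ * ν r)) with hu
  set v : ℝ → ℝ := fun r => -b r - κ * u r / r - k r * u r with hv
  have hud : ∀ r ∈ Ioi (0 : ℝ), HasDerivAt u (v r) r := by
    intro r hr
    have hr0 : 0 < r := hr
    have hνr := hν r hr
    have hrk : 0 < r ^ κ := rpow_pos_of_pos hr0 κ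
    have h := ((hGd r hr).div ((hasDerivAt_rpow_const (p := κ) (Or.inl hr0.ne')).mul (hder r hr))
      (mul_pos hrk hνr).ne').neg
    refine h.congr_deriv ?_
    simp only [hv, hu, hg, Pi.mul_apply]
    rw [rpow_sub_one hr0.ne']
    field_simp
    ring
  have huc : ContinuousOn u (Ioi 0) := fun r hr => (hud r hr).continuousAt.continuousWithinAt
  have hvc : ContinuousOn v (Ioi 0) :=
    (hb.neg.sub ((continuousOn_const.mul huc).div continuousOn_id fun r hr => ne_of_gt hr)).sub
      (hk.mul huc)
  have had : ∀ r ∈ Ioi (0 : ℝ), HasDerivAt (fun r => ∫ s in (1 : ℝ)..r, u s) (u r) r :=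
    fun r hr => intervalIntegral.integral_hasDerivAt_right
      (huc.mono fun s hs => lt_of_lt_of_le (lt_min one_pos hr) hs.1).intervalIntegrable
      (huc.stronglyMeasurableAtFilter isOpen_Ioi r hr) (huc.continuousAt (Ioi_mem_nhds hr))
  refine ⟨fun r => ∫ s in (1 : ℝ)..r, u s, contDiffOn_two_of_hasDerivAt isOpen_Ioi had hud hvc,
    by simp, fun r hr => ?_, fun r hr => ?_⟩
  · have h : deriv (fun r => ∫ s in (1 : ℝ)..r, u s) =ᶠ[𝓝 r] u :=
      by
      filter_upwards [Ioi_mem_nhds hr] with x hx using (had x hx).deriv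
    rw [h.deriv_eq, (hud r hr).deriv, (had r hr).deriv]
    simp only [hv]
    ring
  · have hr0 : 0 < r := hr.1
    have hνr := hν r hr.1
    have hc : 0 < κ - σ - 1 := by linarith
    have hGr : |G r| ≤ ν r * M * (r ^ (κ - σ - 1) / (κ - σ - 1)) := by
      have h := intervalIntegral.norm_integral_le_of_norm_le hr0.le
        (Eventually.of_forall (hbound r hr))
        ((intervalIntegral.intervalIntegrable_rpow' hexp).const_mul _)
      rw [intervalIntegral.integral_const_mul, integral_rpow (Or.inl hexp),
        show κ - σ - 2 + 1 = κ - σ - 1 by ring, zero_rpow hc.ne', sub_zero] at h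
      exact h
    have hsplit : r ^ κ = r ^ (κ - σ - 1) * r ^ (σ + 1) := by
      rw [← rpow_add hr0]; congr 1; ring
    have hrk : 0 < r ^ κ := rpow_pos_of_pos hr0 κ
    rw [(had r hr.1).deriv, hu, abs_neg, abs_div, abs_of_pos (mul_pos hrk hνr)]
    calc r ^ (σ + 1) * (|G r| / (r ^ κ * ν r))
        ≤ r ^ (σ + 1) * (ν r * M * (r ^ (κ - σ - 1) / (κ - σ - 1)) / (r ^ κ * ν r)) := by
          gcongr
      _ = (κ - σ - 1)⁻¹ * M := by
          have h1 : 0 < r ^ (σ + 1) := rpow_pos_of_pos hr0 _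
          have h2 : 0 < r ^ (κ - σ - 1) := rpow_pos_of_pos hr0 _
          rw [hsplit]
          field_simp

/-- solvability with a uniform-in-`t` gradient estimate of the `k = 0` mode ODE
for `L_t^-`: `-a'' - (N-1)a'/r - p a'/(βr + t r^ξ) = b` with `a(1) = 0` and
`sup r^{σ+1}|a'| ≤ C sup r^{σ+2}|b|`. -/
theorem statement9 (N : ℕ) (hN : 3 ≤ N) (p ξ β σ : ℝ)
    (hp1 : (N : ℝ) / ((N : ℝ) - 1) < p) (hp2 : p < 2)
    (hξ : ξ = (p - 1) * ((N : ℝ) - 1)) (hβ : β = (p - 1) / (ξ - 1))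
    (hσ : σ = (2 - p) / (p - 1)) :
    ∃ C : ℝ, 0 < C ∧ ∀ t : ℝ, 0 < t → ∀ b : ℝ → ℝ, ContinuousOn b (Set.Ioc 0 1) →
      BddAbove ((fun r => r ^ (σ + 2) * |b r|) '' Set.Ioo (0 : ℝ) 1) →
      ∃ a : ℝ → ℝ, ContDiffOn ℝ 2 a (Set.Ioc 0 1) ∧ a 1 = 0 ∧
        (∀ r ∈ Set.Ioc (0 : ℝ) 1,
          -deriv (deriv a) r - ((N : ℝ) - 1) * deriv a r / r -
            p * deriv a r / (β * r + t * r ^ ξ) = b r) ∧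
        (∀ r ∈ Set.Ioo (0 : ℝ) 1, r ^ (σ + 1) * |deriv a r| ≤
          C * sSup ((fun r => r ^ (σ + 2) * |b r|) '' Set.Ioo (0 : ℝ) 1)) := by
  have hN1 : (0 : ℝ) < (N : ℝ) - 1 := by
    have : (3 : ℝ) ≤ N := by exact_mod_cast hN
    linarith
  have hp : 1 < p := lt_trans (by rw [one_lt_div hN1]; linarith) hp1
  have hp0 : 0 < p - 1 := by linarith
  have hξ1 : 0 < ξ - 1 := by
    rw [div_lt_iff₀ hN1] at hp1
    rw [hξ]
    nlinarith
  have hβ0 : 0 < β := by rw [hβ]; positivity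
  have hσκ : σ + 1 < (N : ℝ) - 1 := by
    have h : σ + 1 = 1 / (p - 1) := by rw [hσ]; field_simp; ring
    rw [h, div_lt_iff₀ hp0]
    linarith
  refine ⟨((N : ℝ) - 1 - σ - 1)⁻¹, inv_pos.2 (by linarith), fun t ht b hb hbdd => ?_⟩
  have hpos : ∀ r ∈ Ioi (0 : ℝ), 0 < β * r ^ (1 - ξ) + t := fun r hr => by
    have := rpow_pos_of_pos (mem_Ioi.1 hr) (1 - ξ)
    positivity
  have hpos' : ∀ r ∈ Ioi (0 : ℝ), 0 < β * r + t * r ^ ξ := fun r hr => by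
    have hr0 : 0 < r := hr
    positivity
  obtain ⟨a, ha, ha1, hode, hest⟩ := exists_solution_of_monotone_factor hσκ
    (ν := fun r => (β * r ^ (1 - ξ) + t) ^ (-(p / (p - 1))))
    (k := fun r => p / (β * r + t * r ^ ξ)) (b := fun r => b (min r 1))
    (M := sSup ((fun r => r ^ (σ + 2) * |b r|) '' Set.Ioo (0 : ℝ) 1))
    (fun r hr => rpow_pos_of_pos (hpos r hr) _)
    (fun r hr s hs hrs => by
      refine rpow_le_rpow_of_nonpos (hpos s hs) ?_ (neg_nonpos.2 (by positivity))
      have := rpow_le_rpow_of_nonpos hr hrs (by linarith : 1 - ξ ≤ 0)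
      gcongr)
    (fun r hr => by
      have hr0 : 0 < r := hr
      have hA := hpos r hr
      refine ((((hasDerivAt_rpow_const (p := 1 - ξ) (Or.inl hr0.ne')).const_mul β).add_const
        t).rpow_const (p := -(p / (p - 1))) (Or.inl hA.ne')).congr_deriv ?_
      have h1 : β * r + t * r ^ ξ = (β * r ^ (1 - ξ) + t) * r ^ ξ := by
        rw [add_mul, mul_assoc, ← rpow_add hr0]
        simp
      have h2 : r ^ (1 - ξ - 1) = (r ^ ξ)⁻¹ := by
        rw [← rpow_neg hr0.le]; congr 1; ring
      have h3 : β * (ξ - 1) = p - 1 := by rw [hβ]; field_simp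
      have h4 : β * (1 - ξ) * (p / (p - 1)) = -p := by
        rw [show β * (1 - ξ) = -(p - 1) by rw [← h3]; ring]
        field_simp
      have hrξ := rpow_pos_of_pos hr0 ξ
      rw [h1, h2, rpow_sub_one hA.ne']
      calc _ = -(β * (1 - ξ) * (p / (p - 1))) * (r ^ ξ)⁻¹ *
            ((β * r ^ (1 - ξ) + t) ^ (-(p / (p - 1))) / (β * r ^ (1 - ξ) + t)) := by ring
        _ = _ := by rw [h4, neg_neg]; field_simp)
    (continuousOn_const.div (by
      refine (continuousOn_const.mul continuousOn_id).add (continuousOn_const.mul fun s hs => ?_)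
      exact (continuousAt_rpow_const s ξ (Or.inl (ne_of_gt hs))).continuousWithinAt)
      fun r hr => (hpos' r hr).ne')
    (hb.comp (by fun_prop) fun r hr => ⟨lt_min hr one_pos, min_le_right _ _⟩)
    (fun r hr => by
      rw [min_eq_left hr.2.le]
      exact le_csSup hbdd ⟨r, hr, rfl⟩)
  refine ⟨a, ha.mono fun r hr => hr.1, ha1, fun r hr => ?_, hest⟩
  have h := hode r hr.1
  rw [min_eq_left hr.2] at h
  rw [← h]
  ring
end
end

section
/- Let 1 < p ≤ 2. There exists a constant C > 0 such that for all x, y ∈ ℝ^N one has | |x+y|^p − |x|^p − p|x|^{p−2} x·y | ≤ C|y|^p, where |x|^{p−2}x is interpreted as 0 when x = 0. -/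
open Real MeasureTheory Filter Set Metric
open scoped InnerProductSpace Topology ENNReal

noncomputable section

/-- Convexity of `‖·‖ ^ p` at a nonzero point. -/
theorem norm_rpow_add_inner_le {V : Type*} [NormedAddCommGroup V] [InnerProductSpace ℝ V]
    {p : ℝ} (hp : 1 ≤ p) {x : V} (hx : x ≠ 0) (y : V) :
    ‖x‖ ^ p + p * ‖x‖ ^ (p - 2) * ⟪x, y⟫_ℝ ≤ ‖x + y‖ ^ p := by
  have ha : 0 < ‖x‖ := norm_pos_iff.mpr hx
  set t := ⟪x, y⟫_ℝ / ‖x‖ ^ 2 with ht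
  have hxy : ⟪x, y⟫_ℝ = t * ‖x‖ ^ 2 := by rw [ht]; field_simp
  have hpow : ‖x‖ ^ (p - 2) * ‖x‖ ^ 2 = ‖x‖ ^ p := by
    rw [← rpow_natCast, ← rpow_add ha]; norm_num
  have hap : 0 < ‖x‖ ^ p := rpow_pos_of_pos ha p
  have hlhs : ‖x‖ ^ p + p * ‖x‖ ^ (p - 2) * ⟪x, y⟫_ℝ = ‖x‖ ^ p * (1 + p * t) := by
    rw [hxy]; linear_combination (p * t) * hpow
  rw [hlhs]
  rcases le_or_gt (-1) t with h | h
  · have hle : ‖x‖ * (1 + t) ≤ ‖x + y‖ := by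
      have h1 := real_inner_le_norm x (x + y)
      rw [inner_add_right, real_inner_self_eq_norm_sq, hxy] at h1
      exact le_of_mul_le_mul_left (by linarith) ha
    calc ‖x‖ ^ p * (1 + p * t) ≤ ‖x‖ ^ p * (1 + t) ^ p := by
          gcongr; exact one_add_mul_self_le_rpow_one_add h hp
      _ = (‖x‖ * (1 + t)) ^ p := (mul_rpow ha.le (by linarith)).symm
      _ ≤ ‖x + y‖ ^ p :=
          rpow_le_rpow (mul_nonneg ha.le (by linarith)) hle (by linarith)
  · exact (mul_nonpos_of_nonneg_of_nonpos hap.le (by nlinarith)).trans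
      (rpow_nonneg (norm_nonneg _) p)

/-- Concavity of `s ↦ s ^ (p / 2)` applied to `s = ‖x + y‖ ^ 2`. -/
theorem norm_add_rpow_le {V : Type*} [NormedAddCommGroup V] [InnerProductSpace ℝ V]
    {p : ℝ} (hp0 : 0 ≤ p) (hp2 : p ≤ 2) {x : V} (hx : x ≠ 0) (y : V) :
    ‖x + y‖ ^ p ≤
      ‖x‖ ^ p + p * ‖x‖ ^ (p - 2) * ⟪x, y⟫_ℝ + p / 2 * (‖x‖ ^ (p - 2) * ‖y‖ ^ 2) := by
  have ha : 0 < ‖x‖ := norm_pos_iff.mpr hx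
  have hpow : ‖x‖ ^ (p - 2) * ‖x‖ ^ 2 = ‖x‖ ^ p := by
    rw [← rpow_natCast, ← rpow_add ha]; norm_num
  have hsq (z : V) : ‖z‖ ^ p = (‖z‖ ^ 2) ^ (p / 2) := by
    rw [← rpow_natCast, ← rpow_mul (norm_nonneg z)]; congr 1; push_cast; ring
  set t := (2 * ⟪x, y⟫_ℝ + ‖y‖ ^ 2) / ‖x‖ ^ 2 with ht
  have htx : t * ‖x‖ ^ 2 = 2 * ⟪x, y⟫_ℝ + ‖y‖ ^ 2 := by rw [ht]; field_simp
  have hs : ‖x + y‖ ^ 2 = ‖x‖ ^ 2 * (1 + t) := by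
    rw [norm_add_sq_real]; linarith
  have h1t : 0 ≤ 1 + t := by
    have h := sq_nonneg ‖x + y‖
    rw [hs] at h
    exact nonneg_of_mul_nonneg_right h (by positivity)
  calc ‖x + y‖ ^ p = ‖x‖ ^ p * (1 + t) ^ (p / 2) := by
        rw [hsq, hs, mul_rpow (by positivity) h1t, ← hsq]
    _ ≤ ‖x‖ ^ p * (1 + p / 2 * t) := by
        gcongr
        exact rpow_one_add_le_one_add_mul_self (by linarith) (by linarith) (by linarith)
    _ = _ := by
        linear_combination (-(p / 2 * t)) * hpow + (p / 2 * ‖x‖ ^ (p - 2)) * htx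

/-- `| |x+y|^p - |x|^p - p|x|^{p-2} x·y | ≤ C|y|^p` for `1 < p ≤ 2`. -/
theorem statement10 (N : ℕ) (hN : 1 ≤ N) (p : ℝ) (hp1 : 1 < p) (hp2 : p ≤ 2) :
    ∃ C : ℝ, 0 < C ∧ ∀ x y : E N,
      |‖x + y‖ ^ p - ‖x‖ ^ p - p * ‖x‖ ^ (p - 2) * ⟪x, y⟫_ℝ| ≤ C * ‖y‖ ^ p := by
  refine ⟨6, by norm_num, fun x y => ?_⟩
  have hp0 : 0 < p := by linarith
  have hyp : 0 ≤ ‖y‖ ^ p := rpow_nonneg (norm_nonneg y) p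
  rcases eq_or_ne x 0 with rfl | hx
  · simp only [zero_add, norm_zero, inner_zero_left, mul_zero, sub_zero, zero_rpow hp0.ne',
      abs_of_nonneg hyp]
    linarith
  have ha : 0 < ‖x‖ := norm_pos_iff.mpr hx
  have hlow := norm_rpow_add_inner_le hp1.le hx y
  rw [abs_of_nonneg (by linarith)]
  rcases le_or_gt ‖y‖ ‖x‖ with hyx | hyx
  · have hup := norm_add_rpow_le hp0.le hp2 hx y
    have hb : ‖x‖ ^ (p - 2) * ‖y‖ ^ 2 ≤ ‖y‖ ^ p := by
      rcases (norm_nonneg y).eq_or_lt with h0 | h0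
      · simp [← h0, zero_rpow hp0.ne']
      · calc ‖x‖ ^ (p - 2) * ‖y‖ ^ 2 ≤ ‖y‖ ^ (p - 2) * ‖y‖ ^ 2 := by
              exact mul_le_mul_of_nonneg_right
                (rpow_le_rpow_of_nonpos h0 hyx (by linarith)) (by positivity)
          _ = ‖y‖ ^ p := by rw [← rpow_natCast, ← rpow_add h0]; norm_num
    have : p / 2 * (‖x‖ ^ (p - 2) * ‖y‖ ^ 2) ≤ 1 * ‖y‖ ^ p := by
      gcongr; linarith
    linarith
  · have hb : 0 < ‖y‖ := ha.trans hyx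
    have hsum : ‖x + y‖ ^ p ≤ 4 * ‖y‖ ^ p := by
      calc ‖x + y‖ ^ p ≤ (2 * ‖y‖) ^ p := by
            gcongr; linarith [norm_add_le x y]
        _ = 2 ^ p * ‖y‖ ^ p := mul_rpow (by norm_num) hb.le
        _ ≤ 4 * ‖y‖ ^ p := by
            gcongr
            calc (2 : ℝ) ^ p ≤ 2 ^ (2 : ℝ) := rpow_le_rpow_of_exponent_le (by norm_num) hp2
              _ = 4 := by norm_num
    have hcross : ‖x‖ ^ (p - 2) * (‖x‖ * ‖y‖) ≤ ‖y‖ ^ p := by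
      calc ‖x‖ ^ (p - 2) * (‖x‖ * ‖y‖) = ‖x‖ ^ (p - 1) * ‖y‖ := by
            rw [← mul_assoc, ← rpow_add_one ha.ne']; ring_nf
        _ ≤ ‖y‖ ^ (p - 1) * ‖y‖ := by
            exact mul_le_mul_of_nonneg_right (rpow_le_rpow ha.le hyx.le (by linarith)) hb.le
        _ = ‖y‖ ^ p := by rw [← rpow_add_one hb.ne']; ring_nf
    have hinner : -⟪x, y⟫_ℝ ≤ ‖x‖ * ‖y‖ :=
      (neg_le_abs _).trans (abs_real_inner_le_norm x y)
    have : p * (‖x‖ ^ (p - 2) * -⟪x, y⟫_ℝ) ≤ 2 * ‖y‖ ^ p := by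
      calc p * (‖x‖ ^ (p - 2) * -⟪x, y⟫_ℝ) ≤ p * (‖x‖ ^ (p - 2) * (‖x‖ * ‖y‖)) := by gcongr
        _ ≤ 2 * ‖y‖ ^ p := by gcongr
    have hxp : 0 ≤ ‖x‖ ^ p := rpow_nonneg ha.le p
    linarith
end
end

section
/- Let 1 < p ≤ 2. There exists a constant C > 0 such that for all x, y, z ∈ ℝ^N one has | |x+y|^p − p|x|^{p−2} x·y − |x+z|^p + p|x|^{p−2} x·z | ≤ C(|y|^{p−1} + |z|^{p−1})|y − z|, where |x|^{p−2}x is interpreted as 0 when x = 0. -/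
open Real MeasureTheory Filter Set Metric
open scoped InnerProductSpace Topology ENNReal

noncomputable section

section NormRpow

variable {F : Type*} [NormedAddCommGroup F] [InnerProductSpace ℝ F]

theorem norm_rpow_smul_sub_le_of_norm_le {q : ℝ} (hq0 : 0 < q) (hq1 : q ≤ 1) {a b : F}
    (hab : ‖a‖ ≤ ‖b‖) :
    ‖‖b‖ ^ (q - 1) • b - ‖a‖ ^ (q - 1) • a‖ ≤ 4 * ‖b - a‖ ^ q := by
  rcases eq_or_ne b a with rfl | hne
  · simp [hq0.ne']
  have hd : 0 < ‖b - a‖ := norm_pos_iff.2 (sub_ne_zero.2 hne)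
  have hdb : ‖b - a‖ / 2 ≤ ‖b‖ := by linarith [norm_sub_le b a]
  have hb : 0 < ‖b‖ := by linarith
  have hfirst : ‖b‖ ^ (q - 1) * ‖b - a‖ ≤ 2 * ‖b - a‖ ^ q := by
    have h1 : ‖b‖ ^ (q - 1) ≤ (‖b - a‖ / 2) ^ (q - 1) :=
      rpow_le_rpow_of_nonpos (by positivity) hdb (by linarith)
    have h2 : (‖b - a‖ / 2) ^ (q - 1) * (‖b - a‖ / 2) = (‖b - a‖ / 2) ^ q := by
      rw [← rpow_add_one (by positivity)]
      ring_nf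
    have h3 : (‖b - a‖ / 2) ^ q ≤ ‖b - a‖ ^ q :=
      rpow_le_rpow (by positivity) (by linarith) hq0.le
    have h4 := mul_le_mul_of_nonneg_right h1 hd.le
    linarith
  have hsecond : ‖(‖b‖ ^ (q - 1) - ‖a‖ ^ (q - 1)) • a‖ ≤ ‖b‖ ^ (q - 1) * ‖b - a‖ := by
    rcases eq_or_ne a 0 with rfl | ha
    · rw [smul_zero, norm_zero]
      positivity
    have ha' : 0 < ‖a‖ := norm_pos_iff.2 ha
    have h1 : ‖b‖ ^ (q - 1) ≤ ‖a‖ ^ (q - 1) :=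
      rpow_le_rpow_of_nonpos ha' hab (by linarith)
    have h2 : ‖a‖ ^ q ≤ ‖b‖ ^ q := rpow_le_rpow ha'.le hab hq0.le
    have h3 : ‖a‖ ^ (q - 1) * ‖a‖ = ‖a‖ ^ q := by
      rw [← rpow_add_one ha'.ne', sub_add_cancel]
    have h4 : ‖b‖ ^ (q - 1) * ‖b‖ = ‖b‖ ^ q := by
      rw [← rpow_add_one hb.ne', sub_add_cancel]
    have h5 : ‖b‖ ^ (q - 1) * (‖b‖ - ‖a‖) ≤ ‖b‖ ^ (q - 1) * ‖b - a‖ :=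
      mul_le_mul_of_nonneg_left (norm_sub_norm_le b a) (by positivity)
    rw [norm_smul, Real.norm_eq_abs, abs_of_nonpos (by linarith)]
    linarith
  calc ‖‖b‖ ^ (q - 1) • b - ‖a‖ ^ (q - 1) • a‖
      = ‖‖b‖ ^ (q - 1) • (b - a) + (‖b‖ ^ (q - 1) - ‖a‖ ^ (q - 1)) • a‖ := by
        congr 1
        module
    _ ≤ ‖‖b‖ ^ (q - 1) • (b - a)‖ + ‖(‖b‖ ^ (q - 1) - ‖a‖ ^ (q - 1)) • a‖ := norm_add_le _ _
    _ ≤ ‖b‖ ^ (q - 1) * ‖b - a‖ + ‖b‖ ^ (q - 1) * ‖b - a‖ := by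
        gcongr
        rw [norm_smul, Real.norm_eq_abs, abs_of_nonneg (by positivity)]
    _ ≤ 4 * ‖b - a‖ ^ q := by linarith

/-- The map `v ↦ |v|^{q-1} v` is globally Hölder continuous of exponent `q ∈ (0, 1]`. -/
theorem norm_rpow_smul_sub_le {q : ℝ} (hq0 : 0 < q) (hq1 : q ≤ 1) (a b : F) :
    ‖‖b‖ ^ (q - 1) • b - ‖a‖ ^ (q - 1) • a‖ ≤ 4 * ‖b - a‖ ^ q := by
  rcases le_total ‖a‖ ‖b‖ with hab | hab
  · exact norm_rpow_smul_sub_le_of_norm_le hq0 hq1 hab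
  · rw [norm_sub_rev, norm_sub_rev b a]
    exact norm_rpow_smul_sub_le_of_norm_le hq0 hq1 hab

theorem abs_norm_add_rpow_sub_linear_sub_le {p : ℝ} (hp1 : 1 < p) (hp2 : p ≤ 2) (x y z : F) :
    |‖x + y‖ ^ p - p * ‖x‖ ^ (p - 2) * ⟪x, y⟫_ℝ -
        ‖x + z‖ ^ p + p * ‖x‖ ^ (p - 2) * ⟪x, z⟫_ℝ| ≤
      4 * p * (‖y‖ ^ (p - 1) + ‖z‖ ^ (p - 1)) * ‖y - z‖ := by
  have hderiv : ∀ w ∈ closedBall (0 : F) (max ‖y‖ ‖z‖), HasFDerivWithinAt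
      (fun w => ‖x + w‖ ^ p - p * ‖x‖ ^ (p - 2) * ⟪x, w⟫_ℝ)
      ((p * ‖x + w‖ ^ (p - 2)) • innerSL ℝ (x + w) - (p * ‖x‖ ^ (p - 2)) • innerSL ℝ x)
      (closedBall 0 (max ‖y‖ ‖z‖)) w := by
    intro w _
    have h1 := (hasFDerivAt_norm_rpow (x + w) hp1).comp w ((hasFDerivAt_id w).const_add x)
    have h2 := ((innerSL ℝ x).hasFDerivAt (x := w)).const_mul (p * ‖x‖ ^ (p - 2))
    exact (h1.sub h2).hasFDerivWithinAt
  have hbound : ∀ w ∈ closedBall (0 : F) (max ‖y‖ ‖z‖),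
      ‖(p * ‖x + w‖ ^ (p - 2)) • innerSL ℝ (x + w) - (p * ‖x‖ ^ (p - 2)) • innerSL ℝ x‖ ≤
        4 * p * (‖y‖ ^ (p - 1) + ‖z‖ ^ (p - 1)) := by
    intro w hw
    rw [mem_closedBall_zero_iff] at hw
    have hw' : ‖w‖ ^ (p - 1) ≤ ‖y‖ ^ (p - 1) + ‖z‖ ^ (p - 1) := by
      have hy : 0 ≤ ‖y‖ ^ (p - 1) := by positivity
      have hz : 0 ≤ ‖z‖ ^ (p - 1) := by positivity
      rcases le_max_iff.1 hw with h | h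
      · linarith [rpow_le_rpow (norm_nonneg w) h (by linarith : 0 ≤ p - 1)]
      · linarith [rpow_le_rpow (norm_nonneg w) h (by linarith : 0 ≤ p - 1)]
    have hholder := norm_rpow_smul_sub_le (q := p - 1) (by linarith) (by linarith) x (x + w)
    rw [add_sub_cancel_left, show p - 1 - 1 = p - 2 by ring] at hholder
    have heq : (p * ‖x + w‖ ^ (p - 2)) • innerSL ℝ (x + w) - (p * ‖x‖ ^ (p - 2)) • innerSL ℝ x
        = p • innerSL ℝ (‖x + w‖ ^ (p - 2) • (x + w) - ‖x‖ ^ (p - 2) • x) := by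
      ext v
      simp
      ring
    rw [heq, norm_smul, innerSL_apply_norm, Real.norm_eq_abs, abs_of_pos (by linarith)]
    calc p * _ ≤ p * (4 * (‖y‖ ^ (p - 1) + ‖z‖ ^ (p - 1))) := by gcongr; linarith
      _ = _ := by ring
  have h := (convex_closedBall (0 : F) (max ‖y‖ ‖z‖)).norm_image_sub_le_of_norm_hasFDerivWithin_le
    hderiv hbound (x := z) (y := y) (by simp) (by simp)
  rw [Real.norm_eq_abs] at h
  convert h using 2
  ring

end NormRpow

/-- `| |x+y|^p - p|x|^{p-2}x·y - |x+z|^p + p|x|^{p-2}x·z |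
≤ C(|y|^{p-1} + |z|^{p-1})|y-z|` for `1 < p ≤ 2`. -/
theorem statement11 (N : ℕ) (hN : 1 ≤ N) (p : ℝ) (hp1 : 1 < p) (hp2 : p ≤ 2) :
    ∃ C : ℝ, 0 < C ∧ ∀ x y z : E N,
      |‖x + y‖ ^ p - p * ‖x‖ ^ (p - 2) * ⟪x, y⟫_ℝ -
        ‖x + z‖ ^ p + p * ‖x‖ ^ (p - 2) * ⟪x, z⟫_ℝ| ≤
        C * (‖y‖ ^ (p - 1) + ‖z‖ ^ (p - 1)) * ‖y - z‖ :=
  ⟨4 * p, by linarith, abs_norm_add_rpow_sub_linear_sub_le hp1 hp2⟩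
end
end

section
/- For every t ≥ 0, the radial function w(x) = w_t(|x|), where w_t(r) = ∫_r^1 (t y^ξ + β y)^{−1/(p−1)} dy, is a positive C² function on B₁ \ {0} satisfying −Δw = |∇w|^p in B₁ \ {0}, w = 0 on ∂B₁, and w(x) → ∞ as x → 0. -/
open Real MeasureTheory Filter Set Metric
open scoped InnerProductSpace Topology ENNReal

noncomputable section

section Radial

variable {V : Type*} [NormedAddCommGroup V] [InnerProductSpace ℝ V]

theorem hasFDerivAt_norm_of_ne_zero {x : V} (hx : x ≠ 0) :
    HasFDerivAt (fun y : V => ‖y‖) (‖x‖⁻¹ • innerSL ℝ x) x := by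
  have hx' : ‖x‖ ≠ 0 := norm_ne_zero_iff.mpr hx
  have h := (hasStrictFDerivAt_norm_sq x).hasFDerivAt.sqrt (pow_ne_zero 2 hx')
  simp only [Real.sqrt_sq (norm_nonneg _)] at h
  convert h using 1
  ext v
  simp only [smul_apply, innerSL_apply_apply, smul_eq_mul, nsmul_eq_mul,
    Nat.cast_ofNat]
  field_simp

theorem hasFDerivAt_comp_norm {W : ℝ → ℝ} {W' : ℝ} {x : V} (hx : x ≠ 0)
    (hW : HasDerivAt W W' ‖x‖) :
    HasFDerivAt (fun y : V => W ‖y‖) ((W' / ‖x‖) • innerSL ℝ x) x := by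
  have h := hW.comp_hasFDerivAt x (hasFDerivAt_norm_of_ne_zero hx)
  rwa [smul_smul, ← div_eq_mul_inv] at h

theorem contDiffOn_two_of_hasFDerivAt_radial {f : V → ℝ} {h : ℝ → ℝ} {s : Set V}
    (hs : IsOpen s) (hs0 : ∀ x ∈ s, x ≠ 0) (hh : ContDiffOn ℝ 1 h (Ioi 0))
    (hf : ∀ x ∈ s, HasFDerivAt f (h ‖x‖ • innerSL ℝ x) x) :
    ContDiffOn ℝ 2 f s := by
  rw [show (2 : WithTop ℕ∞) = 1 + 1 by norm_num, contDiffOn_succ_iff_fderiv_of_isOpen hs]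
  refine ⟨fun x hx => (hf x hx).differentiableAt.differentiableWithinAt, by simp, ?_⟩
  refine ContDiffOn.congr (f := fun x => h ‖x‖ • innerSL ℝ x) ?_ fun x hx => (hf x hx).fderiv
  have hn : ContDiffOn ℝ 1 (fun x : V => h ‖x‖) s :=
    hh.comp (fun x hx => (contDiffAt_norm ℝ (hs0 x hx)).contDiffWithinAt)
      fun x hx => norm_pos_iff.mpr (hs0 x hx)
  exact hn.smul (innerSL ℝ : V →L[ℝ] V →L[ℝ] ℝ).contDiff.contDiffOn

theorem gradient_eq_of_hasFDerivAt_smul_innerSL [CompleteSpace V] {f : V → ℝ} {c : ℝ} {x : V}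
    (hf : HasFDerivAt f (c • innerSL ℝ x) x) : gradient f x = c • x := by
  apply HasGradientAt.gradient
  rw [hasGradientAt_iff_hasFDerivAt]
  have h : InnerProductSpace.toDual ℝ V (c • x) = c • innerSL ℝ x := by
    ext v
    simp [innerSL_apply_apply]
  rwa [h]

end Radial

theorem lap_eq_of_hasFDerivAt_radial {N : ℕ} {f : E N → ℝ} {h : ℝ → ℝ} {h' : ℝ} {x : E N}
    (hx : x ≠ 0) (hh : HasDerivAt h h' ‖x‖)
    (hf : ∀ᶠ y in 𝓝 x, HasFDerivAt f (h ‖y‖ • innerSL ℝ y) y) :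
    lap f x = h' * ‖x‖ + N * h ‖x‖ := by
  have hx' : ‖x‖ ≠ 0 := norm_ne_zero_iff.mpr hx
  have e : fderiv ℝ f =ᶠ[𝓝 x] fun y => h ‖y‖ • innerSL ℝ y := by
    filter_upwards [hf] with y hy using hy.fderiv
  have d := ((hasFDerivAt_comp_norm hx hh).smul
    (innerSL ℝ : E N →L[ℝ] _).hasFDerivAt).congr_of_eventuallyEq e
  have term : ∀ i : Fin N,
      iteratedFDeriv ℝ 2 f x ![EuclideanSpace.single i 1, EuclideanSpace.single i 1]
        = h' / ‖x‖ * x i ^ 2 + h ‖x‖ := by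
    intro i
    rw [iteratedFDeriv_two_apply, d.fderiv]
    change h ‖x‖ * ⟪EuclideanSpace.single i (1 : ℝ), EuclideanSpace.single i 1⟫_ℝ +
      h' / ‖x‖ * ⟪x, EuclideanSpace.single i 1⟫_ℝ * ⟪x, EuclideanSpace.single i 1⟫_ℝ = _
    simp [EuclideanSpace.inner_single_right]
    ring
  have hn : ∑ i, x i ^ 2 = ‖x‖ ^ 2 := by
    rw [EuclideanSpace.norm_sq_eq]; simp
  unfold lap
  simp only [term]
  rw [Finset.sum_add_distrib, ← Finset.mul_sum, hn]
  simp
  field_simp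

section Profile

variable {ξ β t q : ℝ}

theorem contDiffOn_profile (hβ : 0 < β) (ht : 0 ≤ t) :
    ContDiffOn ℝ 1 (fun r : ℝ => (t * r ^ ξ + β * r) ^ q) (Ioi 0) := by
  intro r (hr : 0 < r)
  have : 0 < t * r ^ ξ + β * r := by positivity
  refine ContDiffAt.contDiffWithinAt ?_
  refine ContDiffAt.rpow_const_of_ne ?_ this.ne'
  exact (contDiffAt_const.mul (contDiffAt_id.rpow_const_of_ne hr.ne')).add
    (contDiffAt_const.mul contDiffAt_id)

theorem hasDerivAt_profile (hβ : 0 < β) (ht : 0 ≤ t) {r : ℝ} (hr : 0 < r) :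
    HasDerivAt (fun r : ℝ => (t * r ^ ξ + β * r) ^ q)
      ((t * (ξ * r ^ (ξ - 1)) + β) * q * (t * r ^ ξ + β * r) ^ (q - 1)) r := by
  have : 0 < t * r ^ ξ + β * r := by positivity
  refine HasDerivAt.rpow_const ?_ (Or.inl this.ne')
  have h := ((Real.hasDerivAt_rpow_const (p := ξ) (Or.inl hr.ne')).const_mul t).add
    ((hasDerivAt_id r).const_mul β)
  rwa [mul_one] at h

theorem intervalIntegrable_profile (hβ : 0 < β) (ht : 0 ≤ t) {r s : ℝ} (hr : 0 < r) (hs : 0 < s) :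
    IntervalIntegrable (fun r : ℝ => (t * r ^ ξ + β * r) ^ q) volume r s := by
  refine ((contDiffOn_profile hβ ht).continuousOn.mono fun y hy => ?_).intervalIntegrable
  exact (lt_min hr hs).trans_le hy.1

theorem hasDerivAt_integral_profile (hβ : 0 < β) (ht : 0 ≤ t) {r : ℝ} (hr : 0 < r) :
    HasDerivAt (fun r : ℝ => ∫ y in r..1, (t * y ^ ξ + β * y) ^ q)
      (-(t * r ^ ξ + β * r) ^ q) r := by
  have hc := (contDiffOn_profile (ξ := ξ) (q := q) hβ ht).continuousOn
  exact intervalIntegral.integral_hasDerivAt_left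
    (intervalIntegrable_profile hβ ht hr one_pos)
    (hc.stronglyMeasurableAtFilter isOpen_Ioi r hr) (hc.continuousAt (Ioi_mem_nhds hr))

theorem integral_profile_pos (hβ : 0 < β) (ht : 0 ≤ t) {r : ℝ} (hr : 0 < r) (hr1 : r < 1) :
    0 < ∫ y in r..1, (t * y ^ ξ + β * y) ^ q := by
  refine intervalIntegral.intervalIntegral_pos_of_pos_on
    (intervalIntegrable_profile hβ ht hr one_pos) (fun y hy => ?_) hr1
  have : 0 < y := hr.trans hy.1
  positivity

theorem neg_log_le_integral_profile (hβ : 0 < β) (ht : 0 ≤ t) (hξ : 1 ≤ ξ) (hq : q ≤ -1)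
    {r : ℝ} (hr : 0 < r) (hr1 : r ≤ 1) :
    (t + β) ^ q * -Real.log r ≤ ∫ y in r..1, (t * y ^ ξ + β * y) ^ q := by
  have h1 : ∫ y in r..1, (t + β) ^ q * y⁻¹ = (t + β) ^ q * -Real.log r := by
    rw [intervalIntegral.integral_const_mul, integral_inv_of_pos hr one_pos, one_div,
      Real.log_inv]
  rw [← h1]
  refine intervalIntegral.integral_mono_on hr1 ?_ (intervalIntegrable_profile hβ ht hr one_pos) ?_
  · refine (ContinuousOn.intervalIntegrable ?_)
    refine continuousOn_const.mul (continuousOn_inv₀.mono fun y hy => ?_)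
    exact ((lt_min hr one_pos).trans_le hy.1).ne'
  · intro y hy
    have hy0 : 0 < y := hr.trans_le hy.1
    have hle : t * y ^ ξ + β * y ≤ (t + β) * y := by
      have := Real.rpow_le_rpow_of_exponent_ge hy0 hy.2 hξ
      rw [Real.rpow_one] at this
      nlinarith
    have hinv : y⁻¹ ≤ y ^ q := by
      rw [← Real.rpow_neg_one]
      exact Real.rpow_le_rpow_of_exponent_ge hy0 hy.2 hq
    calc (t + β) ^ q * y⁻¹ ≤ (t + β) ^ q * y ^ q := by gcongr
      _ = ((t + β) * y) ^ q := (Real.mul_rpow (by positivity) hy0.le).symm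
      _ ≤ _ := Real.rpow_le_rpow_of_nonpos (by positivity) hle (by linarith)

end Profile

theorem wfun_eq_intervalIntegral {N : ℕ} {p ξ β t : ℝ} {x : E N} (hx : ‖x‖ ≤ 1) :
    wfun p ξ β t x = ∫ y in ‖x‖..1, (t * y ^ ξ + β * y) ^ (-(1 / (p - 1))) := by
  rw [wfun, intervalIntegral.integral_of_le hx, integral_Ioc_eq_integral_Ioo]

theorem hasFDerivAt_wfun {N : ℕ} {p ξ β t : ℝ} (hβ : 0 < β) (ht : 0 ≤ t) {x : E N}
    (hx : 0 < ‖x‖) (hx1 : ‖x‖ < 1) :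
    HasFDerivAt (wfun p ξ β t)
      ((-(t * ‖x‖ ^ ξ + β * ‖x‖) ^ (-(1 / (p - 1))) / ‖x‖) • innerSL ℝ x) x := by
  refine (hasFDerivAt_comp_norm (norm_pos_iff.mp hx)
    (hasDerivAt_integral_profile hβ ht hx)).congr_of_eventuallyEq ?_
  filter_upwards [continuous_norm.continuousAt.eventually_lt continuousAt_const hx1] with y hy
  exact wfun_eq_intervalIntegral hy.le

/-- The profile equation `w'' + (N - 1) w' / r = -|w'|^p`, with `w' = -G^{-1/(p-1)}`. -/
theorem profile_ode {n p ξ β t r : ℝ} (hp : 1 < p) (hξ : ξ = (p - 1) * (n - 1)) (hξ1 : 1 < ξ)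
    (hβ : β = (p - 1) / (ξ - 1)) (hβ0 : 0 < β) (ht : 0 ≤ t) (hr : 0 < r) :
    -((t * (ξ * r ^ (ξ - 1)) + β) * (1 / (p - 1)) *
        (t * r ^ ξ + β * r) ^ (-(1 / (p - 1)) - 1) -
      (n - 1) * (t * r ^ ξ + β * r) ^ (-(1 / (p - 1))) / r) =
    ((t * r ^ ξ + β * r) ^ (-(1 / (p - 1)))) ^ p := by
  have hG : 0 < t * r ^ ξ + β * r := by positivity
  have hp' : p - 1 ≠ 0 := by linarith
  have hξ' : ξ - 1 ≠ 0 := by linarith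
  have e1 : (t * r ^ ξ + β * r) ^ (-(1 / (p - 1))) =
      (t * r ^ ξ + β * r) ^ (-(1 / (p - 1)) - 1) * (t * r ^ ξ + β * r) := by
    rw [← Real.rpow_add_one hG.ne', sub_add_cancel]
  have e2 : ((t * r ^ ξ + β * r) ^ (-(1 / (p - 1)))) ^ p =
      (t * r ^ ξ + β * r) ^ (-(1 / (p - 1)) - 1) := by
    rw [← Real.rpow_mul hG.le]
    congr 1
    field_simp
    ring
  have e3 : r ^ ξ = r ^ (ξ - 1) * r := by
    rw [← Real.rpow_add_one hr.ne', sub_add_cancel]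
  have hβ' : β * (ξ - 1) = p - 1 := by rw [hβ]; field_simp
  have hn : n - 1 = ξ / (p - 1) := by rw [hξ]; field_simp
  rw [e2, e1, hn]
  set A := (t * r ^ ξ + β * r) ^ (-(1 / (p - 1)) - 1)
  rw [e3]
  field_simp
  linear_combination A * hβ'

/-- the radial function `w_t` is a positive C² singular solution of
`-Δw = |∇w|^p` in `B₁ \ {0}` with `w = 0` on `∂B₁`, blowing up at the origin. -/
theorem statement13 (N : ℕ) (hN : 3 ≤ N) (p ξ β : ℝ)
    (hp1 : (N : ℝ) / ((N : ℝ) - 1) < p) (hp2 : p < 2)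
    (hξ : ξ = (p - 1) * ((N : ℝ) - 1)) (hβ : β = (p - 1) / (ξ - 1))
    (t : ℝ) (ht : 0 ≤ t) :
    ContDiffOn ℝ 2 (wfun (N := N) p ξ β t) {x : E N | 0 < ‖x‖ ∧ ‖x‖ < 1} ∧
    (∀ x : E N, 0 < ‖x‖ → ‖x‖ < 1 → 0 < wfun p ξ β t x) ∧
    (∀ x : E N, 0 < ‖x‖ → ‖x‖ < 1 →
      -lap (wfun p ξ β t) x = ‖gradient (wfun p ξ β t) x‖ ^ p) ∧
    (∀ x : E N, ‖x‖ = 1 → wfun p ξ β t x = 0) ∧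
    Tendsto (wfun (N := N) p ξ β t) (𝓝[≠] (0 : E N)) atTop := by
  have hN' : (3 : ℝ) ≤ N := by exact_mod_cast hN
  have hpN : (N : ℝ) < p * ((N : ℝ) - 1) := (div_lt_iff₀ (by linarith)).mp hp1
  have hp : 1 < p := by nlinarith
  have hξ1 : 1 < ξ := by rw [hξ]; linarith
  have hβ0 : 0 < β := by rw [hβ]; exact div_pos (by linarith) (by linarith)
  have hopen : IsOpen {x : E N | 0 < ‖x‖ ∧ ‖x‖ < 1} :=
    (isOpen_lt continuous_const continuous_norm).inter (isOpen_lt continuous_norm continuous_const)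
  refine ⟨?_, ?_, ?_, ?_, ?_⟩
  · refine contDiffOn_two_of_hasFDerivAt_radial
      (h := fun r => -(t * r ^ ξ + β * r) ^ (-(1 / (p - 1))) / r) hopen
      (fun x hx => norm_pos_iff.mp hx.1) ?_ fun x hx => hasFDerivAt_wfun hβ0 ht hx.1 hx.2
    exact (contDiffOn_profile hβ0 ht).neg.div contDiffOn_id fun r hr => ne_of_gt hr
  · intro x hx hx1
    rw [wfun_eq_intervalIntegral hx1.le]
    exact integral_profile_pos hβ0 ht hx hx1
  · intro x hx hx1
    rw [gradient_eq_of_hasFDerivAt_smul_innerSL (hasFDerivAt_wfun hβ0 ht hx hx1),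
      lap_eq_of_hasFDerivAt_radial
        (h := fun r => -(t * r ^ ξ + β * r) ^ (-(1 / (p - 1))) / r) (norm_pos_iff.mp hx)
        ((hasDerivAt_profile hβ0 ht hx).neg.div (hasDerivAt_id _) hx.ne')
        (by filter_upwards [hopen.mem_nhds ⟨hx, hx1⟩] with y hy
            using hasFDerivAt_wfun hβ0 ht hy.1 hy.2)]
    have hnorm : ‖(-(t * ‖x‖ ^ ξ + β * ‖x‖) ^ (-(1 / (p - 1))) / ‖x‖) • x‖ =
        (t * ‖x‖ ^ ξ + β * ‖x‖) ^ (-(1 / (p - 1))) := by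
      rw [norm_smul, norm_div, norm_neg, norm_norm, div_mul_cancel₀ _ hx.ne',
        Real.norm_of_nonneg (by positivity)]
    rw [hnorm, ← profile_ode hp hξ hξ1 hβ hβ0 ht hx]
    simp only [Pi.neg_apply]
    field_simp
    ring
  · intro x hx
    rw [wfun_eq_intervalIntegral hx.le, hx, intervalIntegral.integral_same]
  · have hlog : Tendsto (fun x : E N => (t + β) ^ (-(1 / (p - 1))) * -Real.log ‖x‖)
        (𝓝[≠] 0) atTop := by
      refine Tendsto.const_mul_atTop (by positivity) (tendsto_neg_atBot_atTop.comp ?_)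
      exact Real.tendsto_log_nhdsGT_zero.comp tendsto_norm_nhdsNE_zero
    refine tendsto_atTop_mono' _ ?_ hlog
    filter_upwards [self_mem_nhdsWithin, mem_nhdsWithin_of_mem_nhds (ball_mem_nhds 0 one_pos)]
      with x hx hx1
    rw [mem_ball_zero_iff] at hx1
    rw [wfun_eq_intervalIntegral hx1.le]
    refine neg_log_le_integral_profile hβ0 ht hξ1.le ?_ (norm_pos_iff.mpr hx) hx1.le
    rw [neg_le_neg_iff, le_div_iff₀ (by linarith)]
    linarith
end
end

section
/- There exists a constant C = C(β, p) > 0 such that for every t > 0 and every z ∈ (0,1) with t z^{ξ−1} ≤ 1, one has r^σ w_t(r) ≥ C(1 − (r/z)^σ) for all 0 < r < z, where w_t(r) = ∫_r^1 (t y^ξ + β y)^{−1/(p−1)} dy. -/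
open Real MeasureTheory Filter Set Metric
open scoped InnerProductSpace Topology ENNReal

noncomputable section

/-- The factor `t y ^ ξ + β y` is at most `(1 + β) y` as long as `t z ^ (ξ - 1) ≤ 1`. -/
lemma mul_rpow_add_mul_le {ξ β t z y : ℝ} (hξ : 1 < ξ) (ht : 0 < t)
    (htz : t * z ^ (ξ - 1) ≤ 1) (hy : 0 < y) (hyz : y ≤ z) :
    t * y ^ ξ + β * y ≤ (1 + β) * y := by
  have hsplit : y ^ ξ = y ^ (ξ - 1) * y := by
    rw [← rpow_add_one hy.ne', sub_add_cancel]
  have hmono : t * y ^ (ξ - 1) ≤ 1 :=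
    (mul_le_mul_of_nonneg_left (rpow_le_rpow hy.le hyz (by linarith)) ht.le).trans htz
  rw [hsplit]
  nlinarith [mul_le_mul_of_nonneg_right hmono hy.le]

lemma continuousOn_mul_rpow_add_mul_rpow {ξ β t s r : ℝ} (hβ : 0 < β) (ht : 0 < t)
    (hr : 0 < r) : ContinuousOn (fun y : ℝ => (t * y ^ ξ + β * y) ^ s) (Icc r 1) := by
  intro y hy
  have hy0 : 0 < y := hr.trans_le hy.1
  have hpos : 0 < t * y ^ ξ + β * y := by positivity
  have hbase : ContinuousAt (fun y : ℝ => t * y ^ ξ + β * y) y :=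
    ((continuousAt_rpow_const y ξ (Or.inl hy0.ne')).const_mul t).add
      (continuousAt_id.const_mul β)
  exact (hbase.rpow_const (Or.inl hpos.ne')).continuousWithinAt

/-- Lower bound for the radial integral, in terms of `q = 1 / (p - 1)`. -/
lemma rpow_mul_integral_lower_bound {ξ β q t z r : ℝ} (hξ : 1 < ξ) (hβ : 0 < β) (hq : 1 < q)
    (ht : 0 < t) (hz : z < 1) (htz : t * z ^ (ξ - 1) ≤ 1) (hr : 0 < r) (hrz : r < z) :
    (1 + β) ^ (-q) / (q - 1) * (1 - (r / z) ^ (q - 1)) ≤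
      r ^ (q - 1) * ∫ y in Ioo r 1, (t * y ^ ξ + β * y) ^ (-q) := by
  have hz0 : 0 < z := hr.trans hrz
  have hint : IntegrableOn (fun y : ℝ => (t * y ^ ξ + β * y) ^ (-q)) (Ioo r 1) :=
    (continuousOn_mul_rpow_add_mul_rpow hβ ht hr).integrableOn_Icc.mono_set Ioo_subset_Icc_self
  have hzero : (0 : ℝ) ∉ uIcc r z := by
    rw [uIcc_of_le hrz.le]
    exact fun h => absurd h.1 (not_le.mpr hr)
  have hpow : ∫ y in Ioc r z, (1 + β) ^ (-q) * y ^ (-q) =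
      (1 + β) ^ (-q) * ((z ^ (-q + 1) - r ^ (-q + 1)) / (-q + 1)) := by
    rw [integral_const_mul, ← intervalIntegral.integral_of_le hrz.le,
      integral_rpow (Or.inr ⟨by linarith, hzero⟩)]
  have hpowint : IntegrableOn (fun y : ℝ => (1 + β) ^ (-q) * y ^ (-q)) (Ioc r z) :=
    ((intervalIntegrable_iff_integrableOn_Ioc_of_le hrz.le).mp
      (intervalIntegral.intervalIntegrable_rpow (Or.inr hzero))).const_mul _
  have hsub : Ioc r z ⊆ Ioo r 1 := fun y hy => ⟨hy.1, hy.2.trans_lt hz⟩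
  have hcomp : ∫ y in Ioc r z, (1 + β) ^ (-q) * y ^ (-q) ≤
      ∫ y in Ioo r 1, (t * y ^ ξ + β * y) ^ (-q) := by
    refine (setIntegral_mono_on hpowint (hint.mono_set hsub) measurableSet_Ioc ?_).trans
      (setIntegral_mono_set hint ?_ hsub.eventuallyLE)
    · intro y hy
      have hy0 : 0 < y := hr.trans hy.1
      rw [← mul_rpow (by linarith) hy0.le]
      exact rpow_le_rpow_of_nonpos (by positivity)
        (mul_rpow_add_mul_le hξ ht htz hy0 hy.2) (by linarith)
    · filter_upwards [ae_restrict_mem measurableSet_Ioo] with y hy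
      have hy0 : 0 < y := hr.trans hy.1
      show 0 ≤ (t * y ^ ξ + β * y) ^ (-q)
      positivity
  rw [hpow] at hcomp
  refine le_trans (le_of_eq ?_) (mul_le_mul_of_nonneg_left hcomp (rpow_nonneg hr.le (q - 1)))
  have hq1 : q - 1 ≠ 0 := by linarith
  have hr' : r ^ (q - 1) ≠ 0 := (rpow_pos_of_pos hr _).ne'
  have hz' : z ^ (q - 1) ≠ 0 := (rpow_pos_of_pos hz0 _).ne'
  rw [show -q + 1 = -(q - 1) by ring, rpow_neg hz0.le (q - 1), rpow_neg hr.le (q - 1),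
    div_rpow hr.le hz0.le]
  field_simp
  ring

/-- lower bound `r^σ w_t(r) ≥ C(1 - (r/z)^σ)` for `0 < r < z`, whenever
`z ∈ (0,1)` satisfies `t z^{ξ-1} ≤ 1`, with `C = C(β,p)` independent of `t` and `z`. -/
theorem statement16 (N : ℕ) (hN : 3 ≤ N) (p ξ β σ : ℝ)
    (hp1 : (N : ℝ) / ((N : ℝ) - 1) < p) (hp2 : p < 2)
    (hξ : ξ = (p - 1) * ((N : ℝ) - 1)) (hβ : β = (p - 1) / (ξ - 1))
    (hσ : σ = (2 - p) / (p - 1)) :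
    ∃ C : ℝ, 0 < C ∧ ∀ t : ℝ, 0 < t → ∀ z : ℝ, 0 < z → z < 1 → t * z ^ (ξ - 1) ≤ 1 →
      ∀ r : ℝ, 0 < r → r < z →
        C * (1 - (r / z) ^ σ) ≤
          r ^ σ * ∫ y in Set.Ioo r 1, (t * y ^ ξ + β * y) ^ (-(1 / (p - 1))) := by
  have hN' : (3 : ℝ) ≤ N := by exact_mod_cast hN
  have hpN : (N : ℝ) < p * (N - 1) := (div_lt_iff₀ (by linarith)).mp hp1
  have hξ1 : 1 < ξ := by rw [hξ]; linarith
  have hp : 0 < p - 1 := by nlinarith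
  have hβ0 : 0 < β := by rw [hβ]; exact div_pos hp (by linarith)
  have hq : 1 < 1 / (p - 1) := by rw [lt_div_iff₀ hp]; linarith
  have hσq : σ = 1 / (p - 1) - 1 := by
    rw [hσ]
    field_simp
    ring
  refine ⟨(1 + β) ^ (-(1 / (p - 1))) / (1 / (p - 1) - 1),
    div_pos (rpow_pos_of_pos (by linarith) _) (by linarith), ?_⟩
  intro t ht z _ hz htz r hr hrz
  rw [hσq]
  exact rpow_mul_integral_lower_bound hξ1 hβ0 hq ht hz htz hr hrz
end
end

section
/- There exists a constant C > 0 such that for all t > 1, all 0 < R < 1, and every C¹ function ψ on B₁ \ {0} with ‖ψ‖_X ≤ R, one has sup_{0<|x|≤1} |x|^{σ+2} · | |∇w_t(x) + ∇ψ(x)|^p − |∇w_t(x)|^p − p|∇w_t(x)|^{p−2} ∇w_t(x)·∇ψ(x) | ≤ C R^p. -/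
open Real MeasureTheory Filter Set Metric
open scoped InnerProductSpace Topology ENNReal

noncomputable section

/-- The tangent line to `y ↦ y ^ p` at `s > 0` lies below the graph when `1 ≤ p`. -/
theorem rpow_add_tangent_le_rpow {p s y : ℝ} (hp : 1 ≤ p) (hs : 0 < s) (hy : 0 ≤ y) :
    s ^ p + p * s ^ (p - 1) * (y - s) ≤ y ^ p := by
  have h := one_add_mul_self_le_rpow_one_add (s := y / s - 1) (by linarith [div_nonneg hy hs.le]) hp
  rw [add_sub_cancel, div_rpow hy hs.le, le_div_iff₀ (rpow_pos_of_pos hs p)] at h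
  calc s ^ p + p * s ^ (p - 1) * (y - s) = (1 + p * (y / s - 1)) * s ^ p := by
        rw [rpow_sub_one hs.ne']
        field_simp
    _ ≤ y ^ p := h

/-- The tangent line to `y ↦ y ^ q` at `s > 0` lies above the graph when `0 ≤ q ≤ 1`. -/
theorem rpow_le_rpow_add_tangent {q s y : ℝ} (hq0 : 0 ≤ q) (hq1 : q ≤ 1) (hs : 0 < s)
    (hy : 0 ≤ y) : y ^ q ≤ s ^ q + q * s ^ (q - 1) * (y - s) := by
  have h := rpow_one_add_le_one_add_mul_self (s := y / s - 1)
    (by linarith [div_nonneg hy hs.le]) hq0 hq1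
  rw [add_sub_cancel, div_rpow hy hs.le, div_le_iff₀ (rpow_pos_of_pos hs q)] at h
  calc y ^ q ≤ (1 + q * (y / s - 1)) * s ^ q := h
    _ = s ^ q + q * s ^ (q - 1) * (y - s) := by
        rw [rpow_sub_one hs.ne']
        field_simp

/-- For `1 ≤ p ≤ 2`, the first-order Taylor remainder of `v ↦ ‖v‖ ^ p` at `a` with increment `b`
is at most a constant times `‖b‖ ^ p`. -/
theorem abs_norm_add_rpow_sub_le {V : Type*} [NormedAddCommGroup V] [InnerProductSpace ℝ V]
    {p : ℝ} (hp1 : 1 ≤ p) (hp2 : p ≤ 2) (a b : V) :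
    |‖a + b‖ ^ p - ‖a‖ ^ p - p * ‖a‖ ^ (p - 2) * ⟪a, b⟫_ℝ| ≤ 7 * ‖b‖ ^ p := by
  have hp0 : 0 < p := by linarith
  have hB : 0 ≤ ‖b‖ ^ p := by positivity
  rcases eq_or_ne a 0 with rfl | ha
  · simp only [zero_add, norm_zero, zero_rpow hp0.ne', inner_zero_left, mul_zero, sub_zero,
      abs_of_nonneg hB]
    linarith
  have hs : 0 < ‖a‖ := norm_pos_iff.mpr ha
  have hs1 : ‖a‖ ^ (p - 2) * ‖a‖ = ‖a‖ ^ (p - 1) := by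
    rw [← rpow_add_one hs.ne']
    ring_nf
  rcases le_total ‖b‖ ‖a‖ with hba | hab
  · have lower : 0 ≤ ‖a + b‖ ^ p - ‖a‖ ^ p - p * ‖a‖ ^ (p - 2) * ⟪a, b⟫_ℝ := by
      have h := rpow_add_tangent_le_rpow hp1 hs (norm_nonneg (a + b))
      have hin := real_inner_le_norm a (a + b)
      rw [inner_add_right, real_inner_self_eq_norm_sq] at hin
      have hc : 0 ≤ p * ‖a‖ ^ (p - 2) := by positivity
      have hm := mul_le_mul_of_nonneg_left
        (show ⟪a, b⟫_ℝ ≤ ‖a‖ * (‖a + b‖ - ‖a‖) by linarith) hc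
      rw [← hs1] at h
      linarith
    have upper : ‖a + b‖ ^ p ≤
        ‖a‖ ^ p + p * ‖a‖ ^ (p - 2) * ⟪a, b⟫_ℝ + p / 2 * (‖a‖ ^ (p - 2) * ‖b‖ ^ 2) := by
      have h := rpow_le_rpow_add_tangent (q := p / 2) (s := ‖a‖ ^ 2) (y := ‖a + b‖ ^ 2)
        (by linarith) (by linarith) (by positivity) (by positivity)
      have e (c : ℝ) (hc : 0 ≤ c) (q : ℝ) : (c ^ 2) ^ q = c ^ (2 * q) := by
        rw [← rpow_natCast, ← rpow_mul hc, Nat.cast_ofNat]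
      rw [e _ (norm_nonneg _), e _ (norm_nonneg _), e _ (norm_nonneg _), mul_div_cancel₀ p two_ne_zero,
        show 2 * (p / 2 - 1) = p - 2 by ring, norm_add_sq_real] at h
      linarith
    have hsb : ‖a‖ ^ (p - 2) * ‖b‖ ^ 2 ≤ ‖b‖ ^ p := by
      rcases (norm_nonneg b).eq_or_lt with hb | hb
      · simp [← hb, zero_rpow hp0.ne']
      · calc ‖a‖ ^ (p - 2) * ‖b‖ ^ 2 ≤ ‖b‖ ^ (p - 2) * ‖b‖ ^ 2 := by
              gcongr ?_ * _
              exact rpow_le_rpow_of_nonpos hb hba (by linarith)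
          _ = ‖b‖ ^ p := by
              rw [← rpow_natCast ‖b‖ 2, ← rpow_add hb]
              norm_num
    rw [abs_of_nonneg lower]
    nlinarith
  · have hb : 0 < ‖b‖ := hs.trans_le hab
    have h1 : ‖a + b‖ ^ p ≤ 4 * ‖b‖ ^ p := by
      calc ‖a + b‖ ^ p ≤ (2 * ‖b‖) ^ p := by
            gcongr
            linarith [norm_add_le a b]
        _ = 2 ^ p * ‖b‖ ^ p := mul_rpow two_pos.le hb.le
        _ ≤ 2 ^ (2 : ℝ) * ‖b‖ ^ p := by
            gcongr
            norm_num
        _ = 4 * ‖b‖ ^ p := by norm_num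
    have h2 : ‖a‖ ^ p ≤ ‖b‖ ^ p := by gcongr
    have h3 : |p * ‖a‖ ^ (p - 2) * ⟪a, b⟫_ℝ| ≤ 2 * ‖b‖ ^ p := by
      rw [abs_mul, abs_of_nonneg (by positivity : 0 ≤ p * ‖a‖ ^ (p - 2))]
      calc p * ‖a‖ ^ (p - 2) * |⟪a, b⟫_ℝ| ≤ p * ‖a‖ ^ (p - 2) * (‖a‖ * ‖b‖) := by
            gcongr
            exact abs_real_inner_le_norm a b
        _ = p * (‖a‖ ^ (p - 1) * ‖b‖) := by rw [← hs1]; ring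
        _ ≤ 2 * (‖b‖ ^ (p - 1) * ‖b‖) := by
            gcongr
        _ = 2 * ‖b‖ ^ p := by
            rw [← rpow_add_one hb.ne', sub_add_cancel]
    have h4 : 0 ≤ ‖a + b‖ ^ p := by positivity
    have h5 : 0 ≤ ‖a‖ ^ p := by positivity
    rw [abs_le] at h3 ⊢
    constructor <;> linarith [h3.1, h3.2]

/-- quadratic-error estimate
`sup |x|^{σ+2} | |∇w_t+∇ψ|^p - |∇w_t|^p - p|∇w_t|^{p-2}∇w_t·∇ψ | ≤ C R^p`
for `‖ψ‖_X ≤ R`, uniformly in `t > 1`. -/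
theorem statement18 (N : ℕ) (hN : 3 ≤ N) (p ξ β σ : ℝ)
    (hp1 : (N : ℝ) / ((N : ℝ) - 1) < p) (hp2 : p < 2)
    (hξ : ξ = (p - 1) * ((N : ℝ) - 1)) (hβ : β = (p - 1) / (ξ - 1))
    (hσ : σ = (2 - p) / (p - 1)) :
    ∃ C : ℝ, 0 < C ∧ ∀ t : ℝ, 1 < t → ∀ R : ℝ, 0 < R → R < 1 →
      ∀ ψ : E N → ℝ, ContDiffOn ℝ 1 ψ {x : E N | 0 < ‖x‖ ∧ ‖x‖ ≤ 1} →
        (∀ x : E N, 0 < ‖x‖ → ‖x‖ ≤ 1 →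
          ‖x‖ ^ σ * |ψ x| + ‖x‖ ^ (σ + 1) * ‖gradient ψ x‖ ≤ R) →
        ∀ x : E N, 0 < ‖x‖ → ‖x‖ ≤ 1 →
          ‖x‖ ^ (σ + 2) *
            |‖gradw p ξ β t x + gradient ψ x‖ ^ p - ‖gradw p ξ β t x‖ ^ p -
              p * ‖gradw p ξ β t x‖ ^ (p - 2) *
                ⟪gradw p ξ β t x, gradient ψ x⟫_ℝ| ≤ C * R ^ p := by
  have hN' : (3 : ℝ) ≤ N := by exact_mod_cast hN
  have hp : 1 < p := ((one_lt_div (by linarith)).mpr (by linarith)).trans hp1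
  refine ⟨7, by norm_num, fun t _ R _ _ ψ _ hψ x hx hx1 => ?_⟩
  have hσp : σ + 2 = (σ + 1) * p := by
    have : p - 1 ≠ 0 := by linarith
    rw [hσ]
    field_simp
    ring
  have hb : ‖x‖ ^ (σ + 1) * ‖gradient ψ x‖ ≤ R := by
    have : 0 ≤ ‖x‖ ^ σ * |ψ x| := by positivity
    linarith [hψ x hx hx1]
  calc _ ≤ ‖x‖ ^ (σ + 2) * (7 * ‖gradient ψ x‖ ^ p) := by
        gcongr
        exact abs_norm_add_rpow_sub_le hp.le hp2.le _ _
    _ = 7 * (‖x‖ ^ (σ + 1) * ‖gradient ψ x‖) ^ p := by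
        rw [mul_rpow (by positivity) (by positivity), ← rpow_mul hx.le, hσp]
        ring
    _ ≤ 7 * R ^ p := by gcongr
end
end
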